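/- arXiv:1407.5005 — 5 statements merged into one kernel-verified Lean document; each statement's English description precedes it below -/
import Mathlib

section
/- Let θ : ι → ℤ and let M and N be θ-stable left A-modules, finite-dimensional as ℂ-vector spaces, with θ(M) = θ(N) = 0 and with equal dimension vectors d_M = d_N. Then every nonzero A-module homomorphism f : M → N is an isomorphism. -/
/-!  Setup: `A` is an associative unital ℂ-algebra, `ι` a finite index type and
`e : ι → A` a family of pairwise orthogonal idempotents summing to `1`.
For a left `A`-module `M`, finite dimensional over ℂ, the dimension vector is
`d_M (i) = dim_ℂ (e i • M)` and `θ(M) = ∑ i, θ i * d_M i`. -/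

/-- The ℂ-linear endomorphism of `M` given by the action of `a : A`. -/
noncomputable def actMap (A : Type*) [Ring A] [Algebra ℂ A] (a : A)
    (M : Type*) [AddCommGroup M] [Module ℂ M] [Module A M] [IsScalarTower ℂ A M] :
    M →ₗ[ℂ] M where
  toFun m := a • m
  map_add' x y := smul_add a x y
  map_smul' c m := smul_comm a c m

/-- The dimension vector of `M` : `d_M (i) = dim_ℂ (image of `e i • ·`)`. -/
noncomputable def dimVec (A : Type*) [Ring A] [Algebra ℂ A] {ι : Type*} (e : ι → A)
    (M : Type*) [AddCommGroup M] [Module ℂ M] [Module A M] [IsScalarTower ℂ A M]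
    (i : ι) : ℕ :=
  Module.finrank ℂ (LinearMap.range (actMap A (e i) M))

/-- `θ(M) = ∑ i, θ i * d_M i`. -/
noncomputable def thetaVal (A : Type*) [Ring A] [Algebra ℂ A] {ι : Type*} [Fintype ι]
    (e : ι → A) (θ : ι → ℤ)
    (M : Type*) [AddCommGroup M] [Module ℂ M] [Module A M] [IsScalarTower ℂ A M] : ℤ :=
  ∑ i, θ i * (dimVec A e M i : ℤ)

/-- `M` is `θ`-semistable if every `A`-submodule `N ⊆ M` satisfies `θ(N) ≥ θ(M)`. -/
def Semistable (A : Type*) [Ring A] [Algebra ℂ A] {ι : Type*} [Fintype ι]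
    (e : ι → A) (θ : ι → ℤ)
    (M : Type*) [AddCommGroup M] [Module ℂ M] [Module A M] [IsScalarTower ℂ A M] : Prop :=
  ∀ N : Submodule A M, thetaVal A e θ N ≥ thetaVal A e θ M

/-- `M` is `θ`-stable if it is `θ`-semistable and no nonzero proper `A`-submodule `N`
satisfies `θ(N) = θ(M)`. -/
def Stable (A : Type*) [Ring A] [Algebra ℂ A] {ι : Type*} [Fintype ι]
    (e : ι → A) (θ : ι → ℤ)
    (M : Type*) [AddCommGroup M] [Module ℂ M] [Module A M] [IsScalarTower ℂ A M] : Prop :=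
  Semistable A e θ M ∧
    ∀ N : Submodule A M, N ≠ ⊥ → N ≠ ⊤ → thetaVal A e θ N ≠ thetaVal A e θ M

/-- The dimension vector of a submodule `K` is computed by the images `e i • K` inside `M`. -/
theorem dimVec_submodule {A : Type*} [Ring A] [Algebra ℂ A] {ι : Type*} (e : ι → A)
    {M : Type*} [AddCommGroup M] [Module ℂ M] [Module A M] [IsScalarTower ℂ A M]
    (K : Submodule A M) (i : ι) :
    dimVec A e K i =
      Module.finrank ℂ ((K.restrictScalars ℂ).map (actMap A (e i) M)) := by
  have hmap : (K.restrictScalars ℂ).map (actMap A (e i) M) =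
      (LinearMap.range (actMap A (e i) K)).map (K.subtype.restrictScalars ℂ) := by
    ext x
    constructor
    · rintro ⟨y, hy, rfl⟩
      exact ⟨_, ⟨⟨y, hy⟩, rfl⟩, rfl⟩
    · rintro ⟨_, ⟨y, rfl⟩, rfl⟩
      exact ⟨y, y.2, rfl⟩
  rw [hmap]
  exact LinearEquiv.finrank_eq
    (Submodule.equivMapOfInjective (K.subtype.restrictScalars ℂ) K.injective_subtype _)

/-- The dimension vector is additive along the kernel and the range of a homomorphism. -/
theorem dimVec_ker_add_dimVec_range {A : Type*} [Ring A] [Algebra ℂ A] {ι : Type*}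
    {e : ι → A} {i : ι} (hidem : e i * e i = e i)
    {M : Type*} [AddCommGroup M] [Module ℂ M] [Module A M] [IsScalarTower ℂ A M]
    [FiniteDimensional ℂ M]
    {N : Type*} [AddCommGroup N] [Module ℂ N] [Module A N] [IsScalarTower ℂ A N]
    (f : M →ₗ[A] N) :
    dimVec A e (LinearMap.ker f) i + dimVec A e (LinearMap.range f) i = dimVec A e M i := by
  set P := LinearMap.range (actMap A (e i) M) with hP
  set g : P →ₗ[ℂ] N := (f.restrictScalars ℂ).domRestrict P with hg
  have hker : ((LinearMap.ker f).restrictScalars ℂ).map (actMap A (e i) M) =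
      (LinearMap.ker g).map P.subtype := by
    ext x
    constructor
    · rintro ⟨y, hy, rfl⟩
      have hy' : f y = 0 := hy
      refine ⟨⟨e i • y, y, rfl⟩, ?_, rfl⟩
      change f (e i • y) = 0
      rw [map_smul, hy', smul_zero]
    · rintro ⟨⟨_, y, rfl⟩, hy, rfl⟩
      refine ⟨e i • y, hy, ?_⟩
      change e i • e i • y = e i • y
      rw [smul_smul, hidem]
  have hrange : ((LinearMap.range f).restrictScalars ℂ).map (actMap A (e i) N) =
      LinearMap.range g := by
    ext x
    constructor
    · rintro ⟨_, ⟨y, rfl⟩, rfl⟩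
      exact ⟨⟨e i • y, y, rfl⟩, map_smul f (e i) y⟩
    · rintro ⟨⟨_, y, rfl⟩, rfl⟩
      exact ⟨f y, ⟨y, rfl⟩, (map_smul f (e i) y).symm⟩
  rw [dimVec_submodule, dimVec_submodule, hker, hrange, Submodule.finrank_map_subtype_eq,
    add_comm]
  exact g.finrank_range_add_finrank_ker

/-- `θ` is additive along the kernel and the range of a homomorphism. -/
theorem thetaVal_ker_add_thetaVal_range {A : Type*} [Ring A] [Algebra ℂ A]
    {ι : Type*} [Fintype ι] {e : ι → A} (hidem : ∀ i, e i * e i = e i) (θ : ι → ℤ)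
    {M : Type*} [AddCommGroup M] [Module ℂ M] [Module A M] [IsScalarTower ℂ A M]
    [FiniteDimensional ℂ M]
    {N : Type*} [AddCommGroup N] [Module ℂ N] [Module A N] [IsScalarTower ℂ A N]
    (f : M →ₗ[A] N) :
    thetaVal A e θ (LinearMap.ker f) + thetaVal A e θ (LinearMap.range f) =
      thetaVal A e θ M := by
  simp only [thetaVal, ← Finset.sum_add_distrib, ← mul_add, ← Nat.cast_add,
    dimVec_ker_add_dimVec_range (hidem _) f]

/-- Any nonzero homomorphism between `θ`-stable modules with `θ(M) = θ(N) = 0`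
and equal dimension vectors is an isomorphism. -/
theorem stable_hom_bijective (A : Type*) [Ring A] [Algebra ℂ A]
    (ι : Type*) [Fintype ι] (e : ι → A)
    (horth : ∀ i j, i ≠ j → e i * e j = 0) (hidem : ∀ i, e i * e i = e i)
    (hsum : ∑ i, e i = 1) (θ : ι → ℤ)
    (M : Type*) [AddCommGroup M] [Module ℂ M] [Module A M] [IsScalarTower ℂ A M]
    [FiniteDimensional ℂ M]
    (N : Type*) [AddCommGroup N] [Module ℂ N] [Module A N] [IsScalarTower ℂ A N]
    [FiniteDimensional ℂ N]
    (hM : Stable A e θ M) (hN : Stable A e θ N)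
    (hMzero : thetaVal A e θ M = 0) (hNzero : thetaVal A e θ N = 0)
    (hdim : ∀ i, dimVec A e M i = dimVec A e N i)
    (f : M →ₗ[A] N) (hf : f ≠ 0) :
    Function.Bijective f := by
  have hadd := thetaVal_ker_add_thetaVal_range hidem θ f
  have hker := hM.1 (LinearMap.ker f)
  have hrange := hN.1 (LinearMap.range f)
  constructor
  · rw [← LinearMap.ker_eq_bot]
    by_contra h
    exact hM.2 _ h (fun h' => hf (LinearMap.ker_eq_top.mp h')) (by linarith)
  · rw [← LinearMap.range_eq_top]
    by_contra h
    exact hN.2 _ (fun h' => hf (LinearMap.range_eq_bot.mp h')) h (by linarith)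
end

section
/- Let M be a left A-module, finite-dimensional as a ℂ-vector space, with dimension vector d_M = d (so in particular dim_ℂ(e_0 M) = 1). Then: (a) the ℂ-vector space Hom_A(A·e_0, M) of A-module homomorphisms is one-dimensional; and (b) M is θ_T-stable if and only if there exists a surjective A-module homomorphism A·e_0 → M. -/
/-- The stability condition `θ_T` determined by a dimension vector `d` on `Fin (n+1)`:
`θ_T 0 = -∑_{i ≠ 0} d i` and `θ_T i = 1` for `i ≠ 0`. -/
def thetaT {n : ℕ} (d : Fin (n + 1) → ℕ) : Fin (n + 1) → ℤ := fun i =>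
  if i = 0 then -(∑ j ∈ Finset.univ.filter (fun j : Fin (n + 1) => j ≠ 0), (d j : ℤ)) else 1

/-- The left `A`-submodule `A·e₀` of `A`, the image of right multiplication by `e 0`. -/
def Ae0 (A : Type*) [Ring A] {n : ℕ} (e : Fin (n + 1) → A) : Submodule A A :=
  LinearMap.range (LinearMap.toSpanSingleton A A (e 0))

section IdempotentDimension

variable {A : Type*} [Ring A] [Algebra ℂ A] {ι : Type*} (e : ι → A)
  {M : Type*} [AddCommGroup M] [Module ℂ M] [Module A M] [IsScalarTower ℂ A M]

/-- The image of `e i • N` in `M`, for a submodule `N` of `M`. -/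
noncomputable def idempotentImage (N : Submodule A M) (i : ι) : Submodule ℂ M :=
  (LinearMap.range (actMap A (e i) N)).map (N.subtype.restrictScalars ℂ)

lemma dimVec_eq_finrank_idempotentImage (N : Submodule A M) (i : ι) :
    dimVec A e N i = Module.finrank ℂ (idempotentImage e N i) :=
  (Submodule.equivMapOfInjective (N.subtype.restrictScalars ℂ) N.injective_subtype
    (LinearMap.range (actMap A (e i) N))).finrank_eq

lemma mem_idempotentImage {N : Submodule A M} {i : ι} {x : M} :
    x ∈ idempotentImage e N i ↔ ∃ m ∈ N, e i • m = x := by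
  constructor
  · rintro ⟨_, ⟨m, rfl⟩, rfl⟩
    exact ⟨m, m.2, rfl⟩
  · rintro ⟨m, hm, rfl⟩
    exact ⟨_, ⟨⟨m, hm⟩, rfl⟩, rfl⟩

lemma idempotentImage_le_range (N : Submodule A M) (i : ι) :
    idempotentImage e N i ≤ LinearMap.range (actMap A (e i) M) := by
  intro x hx
  obtain ⟨m, -, rfl⟩ := (mem_idempotentImage e).1 hx
  exact ⟨m, rfl⟩

variable [FiniteDimensional ℂ M]

lemma dimVec_submodule_le (N : Submodule A M) (i : ι) : dimVec A e N i ≤ dimVec A e M i := by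
  rw [dimVec_eq_finrank_idempotentImage]
  exact Submodule.finrank_mono (idempotentImage_le_range e N i)

lemma smul_eq_zero_of_dimVec_eq_zero {N : Submodule A M} {i : ι} (h : dimVec A e N i = 0)
    {m : M} (hm : m ∈ N) : e i • m = 0 := by
  rw [dimVec_eq_finrank_idempotentImage, Submodule.finrank_eq_zero] at h
  exact (Submodule.eq_bot_iff _).1 h _ ((mem_idempotentImage e).2 ⟨m, hm, rfl⟩)

lemma smul_mem_of_dimVec_eq {N : Submodule A M} {i : ι} (h : dimVec A e N i = dimVec A e M i)
    (m : M) : e i • m ∈ N := by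
  rw [dimVec_eq_finrank_idempotentImage] at h
  have hm : e i • m ∈ idempotentImage e N i := by
    rw [Submodule.eq_of_le_of_finrank_eq (idempotentImage_le_range e N i) h]
    exact ⟨m, rfl⟩
  obtain ⟨x, hx, hxm⟩ := (mem_idempotentImage e).1 hm
  exact hxm ▸ N.smul_mem _ hx

lemma eq_bot_of_dimVec_eq_zero [Fintype ι] (hsum : ∑ i, e i = 1) {N : Submodule A M}
    (h : ∀ i, dimVec A e N i = 0) : N = ⊥ := by
  refine (Submodule.eq_bot_iff _).2 fun m hm => ?_
  rw [← one_smul A m, ← hsum, Finset.sum_smul]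
  exact Finset.sum_eq_zero fun i _ => smul_eq_zero_of_dimVec_eq_zero e (h i) hm

end IdempotentDimension

section ProjectiveCover

variable {A : Type*} [Ring A] {n : ℕ} (e : Fin (n + 1) → A)

lemma e0_mem_Ae0 : e 0 ∈ Ae0 A e := ⟨1, one_mul _⟩

variable {e}

lemma mul_e0_of_mem_Ae0 (h : e 0 * e 0 = e 0) {x : A} (hx : x ∈ Ae0 A e) : x * e 0 = x := by
  obtain ⟨a, rfl⟩ := hx
  simp [mul_assoc, h]

lemma hom_Ae0_apply (h : e 0 * e 0 = e 0) {M : Type*} [AddCommGroup M] [Module A M]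
    (f : Ae0 A e →ₗ[A] M) (x : Ae0 A e) : f x = (x : A) • f ⟨e 0, e0_mem_Ae0 e⟩ := by
  rw [← map_smul]
  congr 1
  exact Subtype.ext (mul_e0_of_mem_Ae0 h x.2).symm

lemma e0_smul_hom_Ae0_e0 (h : e 0 * e 0 = e 0) {M : Type*} [AddCommGroup M] [Module A M]
    (f : Ae0 A e →ₗ[A] M) :
    e 0 • f ⟨e 0, e0_mem_Ae0 e⟩ = f ⟨e 0, e0_mem_Ae0 e⟩ :=
  (hom_Ae0_apply h f ⟨e 0, e0_mem_Ae0 e⟩).symm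

/-- Evaluation at `e 0` identifies `Hom_A(A·e₀, M)` with `e₀ M`. -/
noncomputable def homAe0Equiv [Algebra ℂ A] (h : e 0 * e 0 = e 0)
    (M : Type*) [AddCommGroup M] [Module ℂ M] [Module A M] [IsScalarTower ℂ A M] :
    (Ae0 A e →ₗ[A] M) ≃ₗ[ℂ] LinearMap.range (actMap A (e 0) M) where
  toFun f := ⟨f ⟨e 0, e0_mem_Ae0 e⟩, _, e0_smul_hom_Ae0_e0 h f⟩
  map_add' _ _ := rfl
  map_smul' _ _ := rfl
  invFun m := (LinearMap.toSpanSingleton A M (m : M)).comp (Ae0 A e).subtype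
  left_inv f := LinearMap.ext fun x => (hom_Ae0_apply h f x).symm
  right_inv := by
    rintro ⟨_, m, rfl⟩
    exact Subtype.ext (by simp [actMap, ← mul_smul, h])

end ProjectiveCover

lemma thetaVal_thetaT {A : Type*} [Ring A] [Algebra ℂ A] {n : ℕ} (e : Fin (n + 1) → A)
    (d : Fin (n + 1) → ℕ)
    (M : Type*) [AddCommGroup M] [Module ℂ M] [Module A M] [IsScalarTower ℂ A M] :
    thetaVal A e (thetaT d) M =
      ∑ i : Fin n, (dimVec A e M i.succ : ℤ) - (∑ i : Fin n, (d i.succ : ℤ)) * dimVec A e M 0 := by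
  have hd : ∑ j ∈ Finset.univ.filter (fun j : Fin (n + 1) => j ≠ 0), (d j : ℤ) =
      ∑ i : Fin n, (d i.succ : ℤ) := by
    rw [Finset.sum_filter, Fin.sum_univ_succ]
    simp
  simp only [thetaVal, thetaT, hd]
  rw [Fin.sum_univ_succ]
  simp
  ring

/-- For `M` with dimension vector `d` (so `dim_ℂ (e₀ M) = 1`):
(a) `Hom_A(A·e₀, M)` is one-dimensional over ℂ, and
(b) `M` is `θ_T`-stable iff there is a surjection of `A`-modules `A·e₀ → M`. -/
theorem hom_from_Ae0_and_stability (A : Type*) [Ring A] [Algebra ℂ A]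
    (n : ℕ) (e : Fin (n + 1) → A)
    (horth : ∀ i j, i ≠ j → e i * e j = 0) (hidem : ∀ i, e i * e i = e i)
    (hsum : ∑ i, e i = 1)
    (d : Fin (n + 1) → ℕ) (hd0 : d 0 = 1)
    (M : Type*) [AddCommGroup M] [Module ℂ M] [Module A M] [IsScalarTower ℂ A M]
    [FiniteDimensional ℂ M]
    (hdM : ∀ i, dimVec A e M i = d i) :
    Module.finrank ℂ (↥(Ae0 A e) →ₗ[A] M) = 1 ∧
      (Stable A e (thetaT d) M ↔
        ∃ f : ↥(Ae0 A e) →ₗ[A] M, Function.Surjective f) := by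
  have h0 := hidem 0
  have hθM : thetaVal A e (thetaT d) M = 0 := by
    simp [thetaVal_thetaT, hdM, hd0]
  refine ⟨?_, ?_, ?_⟩
  · rw [(homAe0Equiv h0 M).finrank_eq]
    exact (hdM 0).trans hd0
  · rintro ⟨hss, hst⟩
    obtain ⟨⟨v, hv⟩, hv0⟩ : ∃ v : LinearMap.range (actMap A (e 0) M), v ≠ 0 := by
      have hpos : 0 < Module.finrank ℂ (LinearMap.range (actMap A (e 0) M)) := by
        have := (hdM 0).trans hd0
        rw [dimVec] at this
        omega
      exact Module.finrank_pos_iff_exists_ne_zero.1 hpos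
    let f : Ae0 A e →ₗ[A] M := (homAe0Equiv h0 M).symm ⟨v, hv⟩
    have hfv : f ⟨e 0, e0_mem_Ae0 e⟩ = v :=
      congrArg Subtype.val ((homAe0Equiv h0 M).apply_symm_apply ⟨v, hv⟩)
    have hvN : v ∈ LinearMap.range f := ⟨_, hfv⟩
    have hvne : v ≠ 0 := fun h => hv0 (Subtype.ext h)
    have hev : e 0 • v = v := hfv ▸ e0_smul_hom_Ae0_e0 h0 f
    have hN0 : dimVec A e (LinearMap.range f) 0 = 1 := by
      have hle := dimVec_submodule_le e (LinearMap.range f) 0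
      have hne : dimVec A e (LinearMap.range f) 0 ≠ 0 := fun h =>
        hvne (hev ▸ smul_eq_zero_of_dimVec_eq_zero e h hvN)
      rw [hdM, hd0] at hle
      omega
    have hθN : thetaVal A e (thetaT d) (LinearMap.range f) ≤ 0 := by
      rw [thetaVal_thetaT, hN0, Nat.cast_one, mul_one, sub_nonpos]
      refine Finset.sum_le_sum fun i _ => ?_
      rw [← hdM]
      exact_mod_cast dimVec_submodule_le e (LinearMap.range f) i.succ
    refine ⟨f, LinearMap.range_eq_top.1 (by_contra fun htop => ?_)⟩
    refine hst _ (fun hbot => hvne ?_) htop (le_antisymm (hθM ▸ hθN) (hss _))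
    rwa [hbot, Submodule.mem_bot] at hvN
  · rintro ⟨f, hf⟩
    have hzero : ∀ N : Submodule A M, N ≠ ⊤ → dimVec A e N 0 = 0 := by
      intro N hN
      by_contra hne
      have hle := dimVec_submodule_le e N 0
      have heq : dimVec A e N 0 = dimVec A e M 0 := by
        rw [hdM, hd0] at hle ⊢
        omega
      refine hN (Submodule.eq_top_iff'.2 fun m => ?_)
      obtain ⟨x, rfl⟩ := hf m
      rw [hom_Ae0_apply h0, ← e0_smul_hom_Ae0_e0 h0]
      exact N.smul_mem _ (smul_mem_of_dimVec_eq e heq _)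
    have hθN : ∀ N : Submodule A M, N ≠ ⊤ →
        thetaVal A e (thetaT d) N = ∑ i : Fin n, (dimVec A e N i.succ : ℤ) := by
      intro N hN
      simp [thetaVal_thetaT, hzero N hN]
    refine ⟨fun N => ?_, fun N hbot htop hθ => hbot ?_⟩
    · by_cases hN : N = ⊤
      · have hdim : ∀ i, dimVec A e N i = dimVec A e M i := by
          subst hN
          intro i
          refine le_antisymm (dimVec_submodule_le e _ i) ?_
          rw [dimVec_eq_finrank_idempotentImage]
          refine Submodule.finrank_mono ?_
          rintro _ ⟨m, rfl⟩
          exact (mem_idempotentImage e).2 ⟨m, trivial, rfl⟩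
        simp [thetaVal, hdim]
      · rw [hθM, hθN N hN]
        positivity
    · rw [hθM, hθN N htop, ← Nat.cast_sum, Nat.cast_eq_zero, Finset.sum_eq_zero_iff] at hθ
      exact eq_bot_of_dimVec_eq_zero e hsum
        (Fin.cases (hzero N htop) fun i => hθ i (Finset.mem_univ i))
end

section
/- Let d : ι → ℕ and θ : ι → ℤ satisfy ∑_{i ∈ ι} θ(i)·d(i) = 0. Let M and N be A^B-modules that are finitely generated and flat as B-modules and such that, for every maximal ideal 𝔪 of B, the A-modules M/𝔪M and N/𝔪N are θ-stable with dimension vector d. Then the following are equivalent: (a) there exist a B-module L, finitely generated and projective with localization L_𝔪 free of rank 1 over B_𝔪 for every maximal ideal 𝔪 of B, and an isomorphism of A^B-modules M ⊗_B L ≅ N; (b) for every maximal ideal 𝔪 of B, the base changes M ⊗_B B_𝔪 and N ⊗_B B_𝔪 are isomorphic as A ⊗_ℂ B_𝔪-modules. -/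
open TensorProduct

/-- The action of `a : A` on an `(A, B)`-module `M`, as a `B`-linear endomorphism. -/
def aAct {A : Type*} [Ring A] (B : Type*) [CommRing B]
    (M : Type*) [AddCommGroup M] [Module A M] [Module B M] [SMulCommClass A B M]
    (a : A) : M →ₗ[B] M where
  toFun m := a • m
  map_add' x y := smul_add a x y
  map_smul' b m := smul_comm a b m

/-- For a maximal ideal `𝔪` of `B`, the subspace `𝔪M` of an `(A,B)`-module `M`,
viewed as an `A`-submodule, so that `M ⧸ fiberSub A M 𝔪` is the fibre `M/𝔪M`
as an `A`-module. -/
def fiberSub (A : Type*) [Ring A] {B : Type*} [CommRing B]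
    (M : Type*) [AddCommGroup M] [Module A M] [Module B M] [SMulCommClass A B M]
    (𝔪 : Ideal B) : Submodule A M where
  carrier := (𝔪 • (⊤ : Submodule B M) : Submodule B M)
  add_mem' hx hy := Submodule.add_mem _ hx hy
  zero_mem' := Submodule.zero_mem _
  smul_mem' a m hm := by
    show a • m ∈ 𝔪 • (⊤ : Submodule B M)
    refine Submodule.smul_induction_on (p := fun z => a • z ∈ 𝔪 • (⊤ : Submodule B M)) hm
      (fun b hb x _ => ?_) (fun x y hx hy => ?_)
    · show a • (b • x) ∈ 𝔪 • (⊤ : Submodule B M)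
      rw [smul_comm]
      exact Submodule.smul_mem_smul hb trivial
    · show a • (x + y) ∈ 𝔪 • (⊤ : Submodule B M)
      rw [smul_add]
      exact Submodule.add_mem _ hx hy

/-- Membership in a submodule can be checked locally at the maximal ideals. -/
theorem Submodule.mem_of_forall_isMaximal_exists_smul_mem {B X : Type*} [CommRing B]
    [AddCommGroup X] [Module B X] (P : Submodule B X) (x : X)
    (h : ∀ (𝔪 : Ideal B) [𝔪.IsMaximal], ∃ s ∉ 𝔪, s • x ∈ P) : x ∈ P := by
  by_contra hx
  have hne : P.comap (LinearMap.toSpanSingleton B X x) ≠ ⊤ := by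
    rw [Ideal.ne_top_iff_one]
    simpa using hx
  obtain ⟨𝔪, hmax, hle⟩ := Ideal.exists_le_maximal _ hne
  obtain ⟨s, hs, hsx⟩ := h 𝔪
  exact hs (hle (by simpa using hsx))

/-- In a noetherian module, the elements that vanish in the localization at a prime `p` are
annihilated by a single element outside `p`. -/
theorem exists_notMem_forall_smul_eq_zero {B X : Type*} [CommRing B] [AddCommGroup X]
    [Module B X] [IsNoetherian B X] (p : Ideal B) [hp : p.IsPrime] :
    ∃ t ∉ p, ∀ x : X, (∃ s ∉ p, s • x = 0) → t • x = 0 := by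
  let K : Submodule B X :=
    { carrier := {x | ∃ s ∉ p, s • x = 0}
      zero_mem' := ⟨1, p.one_notMem, smul_zero _⟩
      add_mem' := by
        rintro x y ⟨s, hs, hx⟩ ⟨t, ht, hy⟩
        refine ⟨s * t, hp.mul_notMem hs ht, ?_⟩
        rw [smul_add, mul_comm, mul_smul, hx, mul_comm, mul_smul, hy]
        simp
      smul_mem' := by
        rintro c x ⟨s, hs, hx⟩
        exact ⟨s, hs, by rw [smul_comm, hx, smul_zero]⟩ }
  have key : ∀ (P : Submodule B X) (_ : P.FG), P ≤ K → ∃ t ∉ p, ∀ x ∈ P, t • x = 0 := by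
    intro P hP
    induction P, hP using Submodule.fg_induction with
    | singleton x =>
      intro hx
      obtain ⟨s, hs, hsx⟩ := hx (Submodule.mem_span_singleton_self x)
      refine ⟨s, hs, fun y hy => ?_⟩
      obtain ⟨c, rfl⟩ := Submodule.mem_span_singleton.1 hy
      rw [smul_comm, hsx, smul_zero]
    | sup P Q _ _ hP hQ =>
      intro hle
      obtain ⟨s, hs, hsx⟩ := hP (le_sup_left.trans hle)
      obtain ⟨t, ht, htx⟩ := hQ (le_sup_right.trans hle)
      refine ⟨s * t, hp.mul_notMem hs ht, fun y hy => ?_⟩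
      obtain ⟨a, ha, b, hb, rfl⟩ := Submodule.mem_sup.1 hy
      rw [smul_add, mul_smul s t b, htx b hb, mul_comm, mul_smul, hsx a ha]
      simp
  obtain ⟨t, ht, h⟩ := key K (IsNoetherian.noetherian K) le_rfl
  exact ⟨t, ht, fun x hx => h x hx⟩

/-- An isomorphism of localizations at a prime lifts, up to a denominator, to a pair of
linear maps that are inverse to each other up to a denominator. -/
theorem exists_quasiInverse_of_localized_equiv {B X Y X' Y' : Type*} [CommRing B]
    [IsNoetherianRing B] [AddCommGroup X] [Module B X] [Module.Finite B X]
    [AddCommGroup Y] [Module B Y] [Module.Finite B Y]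
    [AddCommGroup X'] [Module B X'] [AddCommGroup Y'] [Module B Y']
    (p : Ideal B) [hp : p.IsPrime] (fX : X →ₗ[B] X') [IsLocalizedModule p.primeCompl fX]
    (fY : Y →ₗ[B] Y') [IsLocalizedModule p.primeCompl fY] (g : X' ≃ₗ[B] Y') :
    ∃ (u : X →ₗ[B] Y) (v : Y →ₗ[B] X), ∃ s ∉ p, ∃ t ∉ p,
      (∀ x, fY (u x) = t • g (fX x)) ∧ (∀ x, v (u x) = s • x) ∧ ∀ y, u (v y) = s • y := by
  have := Module.finitePresentation_of_finite B X
  have := Module.finitePresentation_of_finite B Y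
  obtain ⟨u, s₁, hu⟩ := Module.FinitePresentation.exists_lift_of_isLocalizedModule
    p.primeCompl fY (g.toLinearMap ∘ₗ fX)
  obtain ⟨v, s₂, hv⟩ := Module.FinitePresentation.exists_lift_of_isLocalizedModule
    p.primeCompl fX (g.symm.toLinearMap ∘ₗ fY)
  have hu' : ∀ x, fY (u x) = (s₁ : B) • g (fX x) := fun x => LinearMap.congr_fun hu x
  have hv' : ∀ y, fX (v y) = (s₂ : B) • g.symm (fY y) := fun y => LinearMap.congr_fun hv y
  obtain ⟨t₁, ht₁, h₁⟩ := exists_notMem_forall_smul_eq_zero (X := X) p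
  obtain ⟨t₂, ht₂, h₂⟩ := exists_notMem_forall_smul_eq_zero (X := Y) p
  have e₁ : ∀ x, t₁ • (v (u x) - ((s₁ : B) * s₂) • x) = 0 := by
    intro x
    apply h₁
    have h0 : fX (v (u x) - ((s₁ : B) * s₂) • x) = 0 := by
      simp [hu', hv', mul_smul, smul_comm (s₁ : B) (s₂ : B)]
    obtain ⟨c, hc⟩ := (IsLocalizedModule.eq_zero_iff p.primeCompl fX).1 h0
    exact ⟨c, c.2, hc⟩
  have e₂ : ∀ y, t₂ • (u (v y) - ((s₁ : B) * s₂) • y) = 0 := by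
    intro y
    apply h₂
    have h0 : fY (u (v y) - ((s₁ : B) * s₂) • y) = 0 := by
      simp [hu', hv', mul_smul]
    obtain ⟨c, hc⟩ := (IsLocalizedModule.eq_zero_iff p.primeCompl fY).1 h0
    exact ⟨c, c.2, hc⟩
  have e₁' : ∀ x, t₁ • v (u x) = (t₁ * (s₁ * s₂)) • x := fun x => by
    rw [mul_smul]; simpa [smul_sub, sub_eq_zero] using e₁ x
  have e₂' : ∀ y, t₂ • u (v y) = (t₂ * (s₁ * s₂)) • y := fun y => by
    rw [mul_smul]; simpa [smul_sub, sub_eq_zero] using e₂ y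
  refine ⟨u, (t₁ * t₂) • v, t₁ * t₂ * (s₁ * s₂), hp.mul_notMem (hp.mul_notMem ht₁ ht₂)
    (hp.mul_notMem s₁.2 s₂.2), s₁, s₁.2, hu', fun x => ?_, fun y => ?_⟩
  · rw [LinearMap.smul_apply, mul_comm t₁, mul_smul, e₁', ← mul_smul]
    congr 1; ring
  · rw [LinearMap.smul_apply, map_smul, mul_smul, e₂', ← mul_smul]
    congr 1; ring

/-- A finitely generated module all of whose fibres at maximal ideals vanish is zero. -/
theorem subsingleton_of_forall_isMaximal_smul_top {B X : Type*} [CommRing B]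
    [AddCommGroup X] [Module B X] [Module.Finite B X]
    (h : ∀ (𝔪 : Ideal B) [𝔪.IsMaximal], 𝔪 • (⊤ : Submodule B X) = ⊤) : Subsingleton X := by
  refine subsingleton_of_forall_eq 0 fun x => ?_
  rw [← Submodule.mem_bot B]
  refine Submodule.mem_of_forall_isMaximal_exists_smul_mem _ _ fun 𝔪 hmax => ?_
  obtain ⟨r, hr, hr0⟩ := Submodule.exists_sub_one_mem_and_smul_eq_zero_of_fg_of_le_smul 𝔪
    (⊤ : Submodule B X) Module.Finite.fg_top (h 𝔪).ge
  refine ⟨r, fun hrm => hmax.ne_top ?_, hr0 x trivial⟩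
  rw [Ideal.eq_top_iff_one]
  simpa using sub_mem hrm hr

/-- The Nullstellensatz: a maximal ideal of a finite type algebra is the kernel of a character. -/
theorem exists_algHom_ker_eq {k B : Type*} [Field k] [IsAlgClosed k] [CommRing B] [Algebra k B]
    [Algebra.FiniteType k B] (𝔪 : Ideal B) [𝔪.IsMaximal] :
    ∃ χ : B →ₐ[k] k, ∀ b, χ b = 0 ↔ b ∈ 𝔪 := by
  let _ : Field (B ⧸ 𝔪) := Ideal.Quotient.field 𝔪
  have hft : Algebra.FiniteType k (B ⧸ 𝔪) :=
    Algebra.FiniteType.of_surjective (Ideal.Quotient.mkₐ k 𝔪)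
      (Ideal.Quotient.mkₐ_surjective k 𝔪)
  have : Module.Finite k (B ⧸ 𝔪) := finite_of_finite_type_of_isJacobsonRing k (B ⧸ 𝔪)
  have hbij : Function.Bijective (algebraMap k (B ⧸ 𝔪)) :=
    IsAlgClosed.algebraMap_bijective_of_isIntegral
  let ε := AlgEquiv.ofBijective (Algebra.ofId k (B ⧸ 𝔪)) hbij
  refine ⟨ε.symm.toAlgHom.comp (Ideal.Quotient.mkₐ k 𝔪), fun b => ?_⟩
  simp [Ideal.Quotient.eq_zero_iff_mem]

/-- An element of an ideal `I` outside `𝔪 * I` is detected by a functional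
`I → k` that is semilinear along the character `χ` with kernel `𝔪`. -/
theorem exists_semilinear_functional_ne_zero {k B : Type*} [Field k] [CommRing B]
    [Algebra k B] (χ : B →ₐ[k] k) (𝔪 : Ideal B) [𝔪.IsMaximal] (hχ : ∀ b, χ b = 0 ↔ b ∈ 𝔪)
    (I : Ideal B) (y : I) (hy : (y : B) ∉ 𝔪 * I) :
    ∃ l : I →+ k, (∀ (b : B) (x : I), l (b • x) = χ b * l x) ∧ l y ≠ 0 := by
  let _ : Field (B ⧸ 𝔪) := Ideal.Quotient.field 𝔪
  have hne : (Submodule.Quotient.mk y : I ⧸ (𝔪 • (⊤ : Submodule B I))) ≠ 0 := by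
    rw [Ne, Submodule.Quotient.mk_eq_zero]
    intro hmem
    apply hy
    have := Submodule.mem_map_of_mem (f := I.subtype) hmem
    rwa [Submodule.map_smul'', Submodule.map_top, Submodule.range_subtype] at this
  have : ∃ f : Module.Dual (B ⧸ 𝔪) (I ⧸ (𝔪 • (⊤ : Submodule B I))),
      f (Submodule.Quotient.mk y) ≠ 0 := by
    by_contra! h
    exact hne ((Module.forall_dual_apply_eq_zero_iff (B ⧸ 𝔪) _).1 h)
  obtain ⟨f, hf⟩ := this
  let χ' : (B ⧸ 𝔪) →+* k := Ideal.Quotient.lift 𝔪 (χ : B →+* k) fun b hb => (hχ b).2 hb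
  refine ⟨χ'.toAddMonoidHom.comp (f.toAddMonoidHom.comp
    (Submodule.mkQ (𝔪 • (⊤ : Submodule B I))).toAddMonoidHom), fun b x => ?_, ?_⟩
  · have : f (Submodule.Quotient.mk (b • x)) =
        Ideal.Quotient.mk 𝔪 b * f (Submodule.Quotient.mk x) := by
      rw [← smul_eq_mul, ← map_smul]
      rfl
    change χ' (f (Submodule.Quotient.mk (b • x))) = _ * χ' (f (Submodule.Quotient.mk x))
    rw [this, map_mul]
    rfl
  · change χ' (f (Submodule.Quotient.mk y)) ≠ 0
    exact (map_ne_zero χ').2 hf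

section Schur

variable {A : Type*} [Ring A] [Algebra ℂ A] {F : Type*} [AddCommGroup F] [Module ℂ F]
  [Module A F] [IsScalarTower ℂ A F]

theorem dimVec_submodule_s6 {ι : Type*} {e : ι → A} {i : ι} (hi : e i * e i = e i)
    (N : Submodule A F) :
    dimVec A e N i = Module.finrank ℂ
      (LinearMap.range (actMap A (e i) F) ⊓ N.restrictScalars ℂ : Submodule ℂ F) := by
  have hmap : (LinearMap.range (actMap A (e i) N)).map (N.restrictScalars ℂ).subtype =
      LinearMap.range (actMap A (e i) F) ⊓ N.restrictScalars ℂ := by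
    ext x
    constructor
    · rintro ⟨_, ⟨y, rfl⟩, rfl⟩
      exact ⟨⟨(y : F), rfl⟩, N.smul_mem (e i) y.2⟩
    · rintro ⟨⟨y, rfl⟩, hx⟩
      refine ⟨⟨_, hx⟩, ⟨⟨_, hx⟩, Subtype.ext ?_⟩, rfl⟩
      change e i • e i • y = e i • y
      rw [← mul_smul, hi]
  rw [← hmap]
  exact (Submodule.finrank_map_subtype_eq (N.restrictScalars ℂ)
    (LinearMap.range (actMap A (e i) N))).symm

theorem dimVec_ker_add_range [FiniteDimensional ℂ F] {ι : Type*} {e : ι → A} {i : ι}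
    (hi : e i * e i = e i) (f : F →ₗ[A] F) :
    dimVec A e (LinearMap.ker f) i + dimVec A e (LinearMap.range f) i = dimVec A e F i := by
  let W := LinearMap.range (actMap A (e i) F)
  let g : W →ₗ[ℂ] F := (f.restrictScalars ℂ).domRestrict W
  have hrange : LinearMap.range g = W ⊓ (LinearMap.range f).restrictScalars ℂ := by
    ext x
    constructor
    · rintro ⟨⟨_, ⟨y, rfl⟩⟩, rfl⟩
      exact ⟨⟨f y, (map_smul f (e i) y).symm⟩, ⟨_, rfl⟩⟩
    · rintro ⟨⟨y, rfl⟩, ⟨z, hz⟩⟩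
      refine ⟨⟨_, ⟨z, rfl⟩⟩, ?_⟩
      change f (e i • z) = e i • y
      rw [map_smul, hz]
      change e i • e i • y = e i • y
      rw [← mul_smul, hi]
  have hker : (LinearMap.ker g).map W.subtype = W ⊓ (LinearMap.ker f).restrictScalars ℂ := by
    ext x
    constructor
    · rintro ⟨y, hy, rfl⟩
      exact ⟨y.2, hy⟩
    · rintro ⟨hx, hf⟩
      exact ⟨⟨x, hx⟩, hf, rfl⟩
  rw [dimVec_submodule_s6 hi, dimVec_submodule_s6 hi, ← hrange, ← hker,
    ← (Submodule.equivMapOfInjective W.subtype W.injective_subtype _).finrank_eq, add_comm]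
  exact LinearMap.finrank_range_add_finrank_ker g

/-- Schur's lemma: the endomorphisms of a nonzero `θ`-stable module `F` with `θ(F) = 0`
are scalars. -/
theorem Stable.exists_eq_smul [FiniteDimensional ℂ F] [Nontrivial F] {ι : Type*} [Fintype ι]
    {e : ι → A} (hidem : ∀ i, e i * e i = e i) {θ : ι → ℤ} (hF : Stable A e θ F)
    (h0 : thetaVal A e θ F = 0) (f : F →ₗ[A] F) : ∃ c : ℂ, ∀ x, f x = c • x := by
  obtain ⟨c, hc⟩ := Module.End.exists_eigenvalue (K := ℂ) (f.restrictScalars ℂ)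
  let g : F →ₗ[A] F :=
    { toFun := fun x => f x - c • x
      map_add' := fun x y => by simp only [map_add, smul_add]; abel
      map_smul' := fun a x => by simp [smul_sub, smul_comm c a x] }
  have hsum : thetaVal A e θ (LinearMap.ker g) + thetaVal A e θ (LinearMap.range g) = 0 := by
    rw [← h0]
    simp only [thetaVal, ← Finset.sum_add_distrib, ← mul_add]
    exact Finset.sum_congr rfl fun i _ => by rw [← dimVec_ker_add_range (hidem i) g]; simp
  have h₁ := hF.1 (LinearMap.ker g)
  have h₂ := hF.1 (LinearMap.range g)
  have htop : LinearMap.ker g = ⊤ := by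
    by_contra htop
    refine hF.2 _ (fun hbot => ?_) htop (by omega)
    obtain ⟨v, hv⟩ := hc.exists_hasEigenvector
    have hgv : v ∈ LinearMap.ker g := by
      change f v - c • v = 0
      rw [sub_eq_zero]
      exact hv.apply_eq_smul
    rw [hbot] at hgv
    exact hv.2 hgv
  refine ⟨c, fun x => ?_⟩
  have : x ∈ LinearMap.ker g := htop ▸ trivial
  exact sub_eq_zero.1 this

theorem subsingleton_of_dimVec_eq_zero [FiniteDimensional ℂ F] {ι : Type*} [Fintype ι]
    {e : ι → A} (hsum : ∑ i, e i = 1) (h : ∀ i, dimVec A e F i = 0) : Subsingleton F := by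
  refine subsingleton_of_forall_eq 0 fun x => ?_
  rw [← one_smul A x, ← hsum, Finset.sum_smul]
  refine Finset.sum_eq_zero fun i _ => ?_
  have hbot : LinearMap.range (actMap A (e i) F) = ⊥ := Submodule.finrank_eq_zero.1 (h i)
  have : actMap A (e i) F x ∈ LinearMap.range (actMap A (e i) F) := ⟨x, rfl⟩
  rw [hbot] at this
  exact this

end Schur

section Fiber

theorem mem_fiberSub {A B M : Type*} [Ring A] [CommRing B] [AddCommGroup M] [Module A M]
    [Module B M] [SMulCommClass A B M] {𝔪 : Ideal B} {x : M} :
    x ∈ fiberSub A M 𝔪 ↔ x ∈ 𝔪 • (⊤ : Submodule B M) := Iff.rfl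

theorem LinearMap.apply_mem_of_mem_smul_top {B M : Type*} [CommRing B] [AddCommGroup M] [Module B M]
    {I : Ideal B} (ξ : M →ₗ[B] B) {y : M}
    (hy : y ∈ I • (⊤ : Submodule B M)) : ξ y ∈ I := by
  have := Submodule.mem_map_of_mem (f := ξ) hy
  rw [Submodule.map_smul''] at this
  exact Submodule.smul_le.2 (fun r hr n _ => I.mul_mem_right n hr) this

/-- A projective module with nonzero fibre at `𝔪` has a functional that is a unit locally. -/
theorem exists_functional_apply_notMem {A B M : Type*} [Ring A] [CommRing B]
    [AddCommGroup M] [Module A M] [Module B M] [SMulCommClass A B M] {𝔪 : Ideal B}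
    [Module.Projective B M]
    (h : Nontrivial (M ⧸ fiberSub A M 𝔪)) : ∃ (ξ₀ : M →ₗ[B] B) (x₀ : M), ξ₀ x₀ ∉ 𝔪 := by
  by_contra! hcon
  obtain ⟨y, hy⟩ := exists_ne (0 : M ⧸ fiberSub A M 𝔪)
  obtain ⟨z, rfl⟩ := (fiberSub A M 𝔪).mkQ_surjective y
  apply hy
  rw [Submodule.mkQ_apply, Submodule.Quotient.mk_eq_zero, mem_fiberSub]
  obtain ⟨s, hs⟩ := Module.projective_def'.1 ‹Module.Projective B M›
  have hz : Finsupp.linearCombination B id (s z) = z := LinearMap.congr_fun hs z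
  rw [← hz, Finsupp.linearCombination_apply]
  exact Submodule.sum_mem _ fun w _ =>
    Submodule.smul_mem_smul (hcon (Finsupp.lapply w ∘ₗ s) z) trivial

variable {A : Type*} [Ring A] [Algebra ℂ A] {B : Type*} [CommRing B] [Algebra ℂ B]
  {M : Type*} [AddCommGroup M] [Module ℂ M] [Module A M] [Module B M]
  [IsScalarTower ℂ A M] [IsScalarTower ℂ B M] [SMulCommClass A B M]
  {𝔪 : Ideal B} {χ : B →ₐ[ℂ] ℂ}

theorem mkQ_fiberSub_smul (hχ : ∀ b, χ b = 0 ↔ b ∈ 𝔪) (b : B) (x : M) :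
    (fiberSub A M 𝔪).mkQ (b • x) = χ b • (fiberSub A M 𝔪).mkQ x := by
  have : χ b • (fiberSub A M 𝔪).mkQ x = (fiberSub A M 𝔪).mkQ (χ b • x) := rfl
  rw [this, ← sub_eq_zero, ← map_sub, Submodule.mkQ_apply, Submodule.Quotient.mk_eq_zero,
    mem_fiberSub, ← algebraMap_smul B (χ b) x, ← sub_smul]
  refine Submodule.smul_mem_smul ((hχ _).1 ?_) trivial
  simp

theorem finiteDimensional_fiber [Module.Finite B M] (hχ : ∀ b, χ b = 0 ↔ b ∈ 𝔪) :
    FiniteDimensional ℂ (M ⧸ fiberSub A M 𝔪) := by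
  classical
  obtain ⟨s, hs⟩ := (Module.Finite.fg_top : (⊤ : Submodule B M).FG)
  refine ⟨⟨s.image (fiberSub A M 𝔪).mkQ, ?_⟩⟩
  rw [eq_top_iff]
  rintro y -
  obtain ⟨x, rfl⟩ := (fiberSub A M 𝔪).mkQ_surjective y
  have hx : x ∈ Submodule.span B (s : Set M) := hs ▸ trivial
  induction hx using Submodule.span_induction with
  | mem x hx => exact Submodule.subset_span (by simpa using ⟨x, hx, rfl⟩)
  | zero => rw [map_zero]; exact zero_mem _
  | add x y _ _ hx hy => rw [map_add]; exact add_mem hx hy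
  | smul b x _ hx => rw [mkQ_fiberSub_smul hχ]; exact Submodule.smul_mem _ _ hx

/-- A `B`-linear functional on `M` induces a functional on the fibre. -/
theorem exists_fiber_functional (hχ : ∀ b, χ b = 0 ↔ b ∈ 𝔪) (ξ : M →ₗ[B] B) :
    ∃ η : (M ⧸ fiberSub A M 𝔪) →ₗ[ℂ] ℂ, ∀ x, η ((fiberSub A M 𝔪).mkQ x) = χ (ξ x) := by
  let η : (M ⧸ fiberSub A M 𝔪) →+ ℂ := QuotientAddGroup.lift (fiberSub A M 𝔪).toAddSubgroup
    ((χ : B →+ ℂ).comp ξ.toAddMonoidHom) fun x hx => by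
      have hx' : x ∈ 𝔪 • (⊤ : Submodule B M) := hx
      exact (hχ _).2 (ξ.apply_mem_of_mem_smul_top hx')
  have hη : ∀ x, η ((fiberSub A M 𝔪).mkQ x) = χ (ξ x) := fun x => rfl
  refine ⟨{ η with map_smul' := fun c y => ?_ }, hη⟩
  obtain ⟨x, rfl⟩ := (fiberSub A M 𝔪).mkQ_surjective y
  change η ((fiberSub A M 𝔪).mkQ (c • x)) = c • η ((fiberSub A M 𝔪).mkQ x)
  rw [hη, hη, ← algebraMap_smul B c x, map_smul, smul_eq_mul, map_mul]
  simp

/-- If the endomorphisms of the fibre are scalars, then so are the equivariant semilinear maps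
from `M` to the fibre. -/
theorem exists_eq_smul_mkQ (hχ : ∀ b, χ b = 0 ↔ b ∈ 𝔪)
    (hend : ∀ f : (M ⧸ fiberSub A M 𝔪) →ₗ[A] (M ⧸ fiberSub A M 𝔪), ∃ c : ℂ, ∀ x, f x = c • x)
    (u : M →ₗ[A] M ⧸ fiberSub A M 𝔪) (hu : ∀ (b : B) x, u (b • x) = χ b • u x) :
    ∃ c : ℂ, ∀ x, u x = c • (fiberSub A M 𝔪).mkQ x := by
  have hle : fiberSub A M 𝔪 ≤ LinearMap.ker u := by
    intro x hx
    rw [LinearMap.mem_ker]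
    refine Submodule.smul_induction_on (p := fun z => u z = 0) (mem_fiberSub.1 hx)
      (fun b hb x _ => ?_) (fun x y hx hy => ?_)
    · rw [hu, (hχ b).2 hb, zero_smul]
    · rw [map_add, hx, hy, add_zero]
  obtain ⟨c, hc⟩ := hend ((fiberSub A M 𝔪).liftQ u hle)
  exact ⟨c, fun x => hc ((fiberSub A M 𝔪).mkQ x)⟩

/-- The map `I M → M / 𝔪 M` induced by a semilinear functional `l` on the ideal `I`
and a finite dual basis `(ξ j, x j)` of `M`. -/
theorem exists_map_smul_top_fiber (hχ : ∀ b, χ b = 0 ↔ b ∈ 𝔪) {n : ℕ} (ξ : Fin n → M →ₗ[B] B)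
    (x : Fin n → M) (hx : ∀ y, ∑ j, ξ j y • x j = y) (I : Ideal B) (l : I →+ ℂ)
    (hl : ∀ (b : B) (y : I), l (b • y) = χ b * l y) :
    ∃ Λ : (I • (⊤ : Submodule B M) : Submodule B M) →+ M ⧸ fiberSub A M 𝔪,
      ∀ (b : I) (y : M) (h : (b : B) • y ∈ I • (⊤ : Submodule B M)),
        Λ ⟨(b : B) • y, h⟩ = l b • (fiberSub A M 𝔪).mkQ y := by
  refine ⟨
    { toFun := fun y => ∑ j, l ⟨ξ j y, (ξ j).apply_mem_of_mem_smul_top y.2⟩ •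
        (fiberSub A M 𝔪).mkQ (x j)
      map_zero' := Finset.sum_eq_zero fun j _ => ?_
      map_add' := fun y z => ?_ }, fun b y h => ?_⟩
  · have : (⟨ξ j (0 : (I • (⊤ : Submodule B M) : Submodule B M)),
        (ξ j).apply_mem_of_mem_smul_top (Submodule.zero_mem _)⟩ : I) = 0 :=
      Subtype.ext (map_zero (ξ j))
    rw [this, map_zero, zero_smul]
  · rw [← Finset.sum_add_distrib]
    refine Finset.sum_congr rfl fun j _ => ?_
    rw [← add_smul, ← map_add]
    congr 2
    exact Subtype.ext (map_add (ξ j) _ _)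
  · change ∑ j, l ⟨ξ j ((b : B) • y), _⟩ • (fiberSub A M 𝔪).mkQ (x j) = _
    conv_rhs => rw [← hx y, map_sum, Finset.smul_sum]
    refine Finset.sum_congr rfl fun j _ => ?_
    rw [mkQ_fiberSub_smul hχ, smul_smul, mul_comm, ← hl]
    congr 2
    exact Subtype.ext (by simp [mul_comm])

/-- The inductive step of `exists_smul_eq_smul_of_equivariant`. -/
theorem apply_mem_mul_smul_top [𝔪.IsMaximal] (hχ : ∀ b, χ b = 0 ↔ b ∈ 𝔪)
    (hend : ∀ f : (M ⧸ fiberSub A M 𝔪) →ₗ[A] (M ⧸ fiberSub A M 𝔪), ∃ c : ℂ, ∀ x, f x = c • x)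
    {n : ℕ} (ξ : Fin n → M →ₗ[B] B) (x : Fin n → M) (hx : ∀ y, ∑ j, ξ j y • x j = y)
    (h : M →ₗ[B] M) (hA : ∀ (a : A) y, h (a • y) = a • h y)
    (ξ₀ : M →ₗ[B] B) (x₀ : M) (h₀ : ξ₀ x₀ ∉ 𝔪) (hh₀ : ξ₀ (h x₀) = 0)
    (I : Ideal B) (hI : ∀ y, h y ∈ I • (⊤ : Submodule B M)) (y : M) :
    h y ∈ (𝔪 * I) • (⊤ : Submodule B M) := by
  rw [← hx (h y)]
  refine Submodule.sum_mem _ fun j _ => Submodule.smul_mem_smul ?_ trivial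
  by_contra hj
  obtain ⟨l, hl, hne⟩ := exists_semilinear_functional_ne_zero χ 𝔪 hχ I
    ⟨ξ j (h y), (ξ j).apply_mem_of_mem_smul_top (hI y)⟩ hj
  obtain ⟨Λ, hΛ⟩ := exists_map_smul_top_fiber (A := A) hχ ξ x hx I l hl
  have hΛA : ∀ (a : A) (z : M) (hz : z ∈ I • (⊤ : Submodule B M))
      (hz' : a • z ∈ I • (⊤ : Submodule B M)), Λ ⟨a • z, hz'⟩ = a • Λ ⟨z, hz⟩ := by
    intro a z hz
    induction hz using Submodule.smul_induction_on' with
    | smul b hb z _ =>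
      intro hz'
      have e : a • b • z = b • a • z := smul_comm a b z
      have hz'' : b • a • z ∈ I • (⊤ : Submodule B M) := e ▸ hz'
      have : (⟨a • b • z, hz'⟩ : (I • (⊤ : Submodule B M) : Submodule B M)) =
        ⟨b • a • z, hz''⟩ := Subtype.ext e
      rw [this, hΛ ⟨b, hb⟩ (a • z), hΛ ⟨b, hb⟩ z, map_smul, smul_comm]
    | add z hz w hw ihz ihw =>
      intro hz'
      have hz₁ : a • z ∈ I • (⊤ : Submodule B M) := (fiberSub A M I).smul_mem a hz
      have hw₁ : a • w ∈ I • (⊤ : Submodule B M) := (fiberSub A M I).smul_mem a hw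
      have e₁ : (⟨a • (z + w), hz'⟩ : (I • (⊤ : Submodule B M) : Submodule B M)) =
        ⟨a • z, hz₁⟩ + ⟨a • w, hw₁⟩ := Subtype.ext (smul_add a z w)
      have e₂ : (⟨z + w, add_mem hz hw⟩ : (I • (⊤ : Submodule B M) : Submodule B M)) =
        ⟨z, hz⟩ + ⟨w, hw⟩ := rfl
      rw [e₁, e₂, map_add, map_add, ihz, ihw, smul_add]
  have hΛB : ∀ (c : B) (z : M) (hz : z ∈ I • (⊤ : Submodule B M))
      (hz' : c • z ∈ I • (⊤ : Submodule B M)), Λ ⟨c • z, hz'⟩ = χ c • Λ ⟨z, hz⟩ := by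
    intro c z hz
    induction hz using Submodule.smul_induction_on' with
    | smul b hb z _ =>
      intro hz'
      have e : c • b • z = b • c • z := smul_comm c b z
      have hz'' : b • c • z ∈ I • (⊤ : Submodule B M) := e ▸ hz'
      have : (⟨c • b • z, hz'⟩ : (I • (⊤ : Submodule B M) : Submodule B M)) =
        ⟨b • c • z, hz''⟩ := Subtype.ext e
      rw [this, hΛ ⟨b, hb⟩ (c • z), hΛ ⟨b, hb⟩ z, mkQ_fiberSub_smul hχ, smul_comm]
    | add z hz w hw ihz ihw =>
      intro hz'
      have hz₁ : c • z ∈ I • (⊤ : Submodule B M) := Submodule.smul_mem _ c hz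
      have hw₁ : c • w ∈ I • (⊤ : Submodule B M) := Submodule.smul_mem _ c hw
      have e₁ : (⟨c • (z + w), hz'⟩ : (I • (⊤ : Submodule B M) : Submodule B M)) =
        ⟨c • z, hz₁⟩ + ⟨c • w, hw₁⟩ := Subtype.ext (smul_add c z w)
      have e₂ : (⟨z + w, add_mem hz hw⟩ : (I • (⊤ : Submodule B M) : Submodule B M)) =
        ⟨z, hz⟩ + ⟨w, hw⟩ := rfl
      rw [e₁, e₂, map_add, map_add, ihz, ihw, smul_add]
  have hΛξ : ∀ (η : (M ⧸ fiberSub A M 𝔪) →ₗ[ℂ] ℂ) (ζ : M →ₗ[B] B)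
      (_ : ∀ w, η ((fiberSub A M 𝔪).mkQ w) = χ (ζ w)) (z : M)
      (hz : z ∈ I • (⊤ : Submodule B M)),
      η (Λ ⟨z, hz⟩) = l ⟨ζ z, ζ.apply_mem_of_mem_smul_top hz⟩ := by
    intro η ζ hη z hz
    induction hz using Submodule.smul_induction_on' with
    | smul b hb z _ =>
      rw [hΛ ⟨b, hb⟩ z, map_smul, hη, smul_eq_mul, mul_comm, ← hl]
      congr 1
      exact Subtype.ext (by simp [mul_comm])
    | add z hz w hw ihz ihw =>
      have e₂ : (⟨z + w, add_mem hz hw⟩ : (I • (⊤ : Submodule B M) : Submodule B M)) =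
        ⟨z, hz⟩ + ⟨w, hw⟩ := rfl
      rw [e₂, map_add, map_add, ihz, ihw, ← map_add]
      congr 1
      exact Subtype.ext (map_add ζ z w).symm
  let u : M →ₗ[A] M ⧸ fiberSub A M 𝔪 :=
    { toFun := fun z => Λ ⟨h z, hI z⟩
      map_add' := fun z w => by
        rw [← map_add]
        congr 1
        exact Subtype.ext (map_add h z w)
      map_smul' := fun a z => by
        rw [RingHom.id_apply, ← hΛA a (h z) (hI z) ((fiberSub A M I).smul_mem a (hI z))]
        congr 1
        exact Subtype.ext (hA a z) }
  have hu : ∀ z, u z = Λ ⟨h z, hI z⟩ := fun z => rfl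
  obtain ⟨c, hc⟩ := exists_eq_smul_mkQ hχ hend u fun b z => by
    rw [hu, hu, ← hΛB b (h z) (hI z) (Submodule.smul_mem _ b (hI z))]
    congr 1
    exact Subtype.ext (map_smul h b z)
  obtain ⟨η₀, hη₀⟩ := exists_fiber_functional (A := A) hχ ξ₀
  have hc0 : c = 0 := by
    have e₁ : η₀ (u x₀) = 0 := by
      rw [hu, hΛξ η₀ ξ₀ hη₀]
      have : (⟨ξ₀ (h x₀), ξ₀.apply_mem_of_mem_smul_top (hI x₀)⟩ : I) = 0 := Subtype.ext hh₀
      rw [this, map_zero]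
    rw [hc, map_smul, hη₀, smul_eq_mul] at e₁
    exact (mul_eq_zero.1 e₁).resolve_right fun h' => h₀ ((hχ _).1 h')
  obtain ⟨η, hη⟩ := exists_fiber_functional (A := A) hχ (ξ j)
  apply hne
  rw [← hΛξ η (ξ j) hη (h y) (hI y), ← hu, hc, hc0, zero_smul, map_zero]

/-- If the endomorphisms of the fibre of `M` at `𝔪` are scalars, then every equivariant
endomorphism of `M` is, locally at `𝔪`, a scalar. -/
theorem exists_smul_eq_smul_of_equivariant [IsNoetherianRing B] [Module.Finite B M]
    [Module.Projective B M] [𝔪.IsMaximal] (hχ : ∀ b, χ b = 0 ↔ b ∈ 𝔪)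
    (hend : ∀ f : (M ⧸ fiberSub A M 𝔪) →ₗ[A] (M ⧸ fiberSub A M 𝔪), ∃ c : ℂ, ∀ x, f x = c • x)
    (ξ₀ : M →ₗ[B] B) (x₀ : M) (h₀ : ξ₀ x₀ ∉ 𝔪)
    (h : M →ₗ[B] M) (hA : ∀ (a : A) y, h (a • y) = a • h y) :
    ∃ t ∉ 𝔪, ∃ b : B, ∀ y, t • h y = b • y := by
  have hp : 𝔪.IsPrime := inferInstance
  obtain ⟨n, p, i, -, -, hpi⟩ := Module.Finite.exists_comp_eq_id_of_projective B M
  let ξ : Fin n → M →ₗ[B] B := fun j => LinearMap.proj j ∘ₗ i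
  let x : Fin n → M := fun j => p (Pi.single j 1)
  have hx : ∀ y, ∑ j, ξ j y • x j = y := by
    intro y
    have : p (i y) = y := LinearMap.congr_fun hpi y
    conv_rhs => rw [← this, pi_eq_sum_univ' (i y), map_sum]
    refine Finset.sum_congr rfl fun j _ => ?_
    rw [map_smul]
    congr 2
  let h' : M →ₗ[B] M := ξ₀ x₀ • h - ξ₀ (h x₀) • LinearMap.id
  have hh' : ∀ y, h' y = ξ₀ x₀ • h y - ξ₀ (h x₀) • y := fun y => rfl
  have hA' : ∀ (a : A) y, h' (a • y) = a • h' y := fun a y => by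
    rw [hh', hh', hA, smul_sub, smul_comm a, smul_comm a]
  have hpow : ∀ k : ℕ, ∀ y, h' y ∈ (𝔪 ^ k) • (⊤ : Submodule B M) := by
    intro k
    induction k with
    | zero => simp
    | succ k ih =>
      rw [pow_succ']
      exact apply_mem_mul_smul_top hχ hend ξ x hx h' hA' ξ₀ x₀ h₀
        (by simp [hh', mul_comm]) _ ih
  obtain ⟨t, ht, htx⟩ := exists_notMem_forall_smul_eq_zero (X := M) 𝔪
  have hzero : ∀ y, t • h' y = 0 := by
    intro y
    apply htx
    obtain ⟨r, hr⟩ := (Ideal.mem_iInf_smul_pow_eq_bot_iff 𝔪 (h' y)).1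
      ((Submodule.mem_iInf _).2 fun k => hpow k y)
    refine ⟨1 - r, fun hmem => hp.ne_top ?_, by rw [sub_smul, one_smul, hr, sub_self]⟩
    rw [Ideal.eq_top_iff_one]
    simpa using add_mem hmem r.2
  refine ⟨t * ξ₀ x₀, hp.mul_notMem ht h₀, t * ξ₀ (h x₀), fun y => ?_⟩
  have := hzero y
  rwa [hh', smul_sub, sub_eq_zero, smul_smul, smul_smul] at this

end Fiber

section Localization

variable {B : Type*} [CommRing B] (p : Ideal B) [hp : p.IsPrime]
  {X : Type*} [AddCommGroup X] [Module B X]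

theorem LocalizedModule.map_bijective_of_quasiInverse {Y : Type*} [AddCommGroup Y] [Module B Y]
    (u : X →ₗ[B] Y) (v : Y →ₗ[B] X) {s : B} (hs : s ∉ p) (hvu : ∀ x, v (u x) = s • x)
    (huv : ∀ y, u (v y) = s • y) : Function.Bijective (LocalizedModule.map p.primeCompl u) := by
  constructor
  · rw [injective_iff_map_eq_zero]
    intro z hz
    induction z using LocalizedModule.induction_on with
    | h x t =>
      rw [LocalizedModule.map_mk, IsLocalizedModule.mk_eq_mk', IsLocalizedModule.mk'_eq_zero'] at hz
      obtain ⟨c, hc⟩ := hz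
      rw [IsLocalizedModule.mk_eq_mk', IsLocalizedModule.mk'_eq_zero']
      refine ⟨c * ⟨s, hs⟩, ?_⟩
      have : v ((c : B) • u x) = 0 := by
        rw [show (c : B) • u x = 0 from hc, map_zero]
      rw [map_smul, hvu] at this
      rw [mul_smul]
      exact this
  · intro z
    induction z using LocalizedModule.induction_on with
    | h y t =>
      refine ⟨LocalizedModule.mk (v y) (⟨s, hs⟩ * t), ?_⟩
      rw [LocalizedModule.map_mk, huv]
      exact LocalizedModule.mk_cancel_common_left ⟨s, hs⟩ t y

theorem nonempty_localizedModule_equiv_localization (f : X)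
    (hinj : ∀ b : B, b • f = 0 → ∃ s ∉ p, s * b = 0)
    (hsurj : ∀ h : X, ∃ s ∉ p, ∃ b : B, s • h = b • f) :
    Nonempty (LocalizedModule p.primeCompl X ≃ₗ[Localization.AtPrime p]
      Localization.AtPrime p) := by
  let φ := LinearMap.toSpanSingleton (Localization.AtPrime p) (LocalizedModule p.primeCompl X)
    (LocalizedModule.mk f 1)
  have hφ : ∀ b s, φ (Localization.mk b s) = LocalizedModule.mk (b • f) s := fun b s => by
    rw [LinearMap.toSpanSingleton_apply, LocalizedModule.mk_smul_mk, mul_one]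
  refine ⟨(LinearEquiv.ofBijective φ ⟨?_, fun z => ?_⟩).symm⟩
  · rw [injective_iff_map_eq_zero]
    intro z hz
    induction z using Localization.induction_on with
    | H y =>
      obtain ⟨b, t⟩ := y
      rw [hφ, IsLocalizedModule.mk_eq_mk', IsLocalizedModule.mk'_eq_zero'] at hz
      obtain ⟨c, hc⟩ := hz
      obtain ⟨s, hs, hsb⟩ := hinj ((c : B) * b) (by rw [mul_smul]; exact hc)
      rw [Localization.mk_eq_mk', IsLocalization.mk'_eq_zero_iff]
      exact ⟨⟨s, hs⟩ * c, by rw [← hsb]; simp [mul_assoc]⟩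
  · induction z using LocalizedModule.induction_on with
    | h x t =>
      obtain ⟨s, hs, b, hb⟩ := hsurj x
      refine ⟨Localization.mk b (⟨s, hs⟩ * t), ?_⟩
      rw [hφ, ← hb]
      exact LocalizedModule.mk_cancel_common_left ⟨s, hs⟩ t x

end Localization

/-- The `B`-module of `A`-equivariant `B`-linear maps `M → N`. -/
def equivariantHom (A : Type*) [Ring A] (B : Type*) [CommRing B]
    (M : Type*) [AddCommGroup M] [Module A M] [Module B M]
    (N : Type*) [AddCommGroup N] [Module A N] [Module B N] [SMulCommClass A B N] :
    Submodule B (M →ₗ[B] N) where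
  carrier := {f | ∀ (a : A) x, f (a • x) = a • f x}
  zero_mem' a x := by simp
  add_mem' hf hg a x := by simp [hf a x, hg a x]
  smul_mem' b f hf a x := by simp [hf a x, smul_comm a b]

section Equivariant

variable {A : Type*} [Ring A] {B : Type*} [CommRing B]
  {M : Type*} [AddCommGroup M] [Module A M] [Module B M] [SMulCommClass A B M]
  {N : Type*} [AddCommGroup N] [Module A N] [Module B N] [SMulCommClass A B N]

/-- An equivariant isomorphism of localizations lifts, up to a denominator, to a pair of
equivariant maps that are inverse to each other up to a denominator. -/
theorem exists_equivariant_quasiInverse [IsNoetherianRing B] [Module.Finite B M]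
    [Module.Finite B N] (p : Ideal B) [hp : p.IsPrime]
    (g : LocalizedModule p.primeCompl M ≃ₗ[Localization.AtPrime p]
      LocalizedModule p.primeCompl N)
    (hg : ∀ (a : A) (x : LocalizedModule p.primeCompl M),
      g (LocalizedModule.map p.primeCompl (aAct B M a) x) =
        LocalizedModule.map p.primeCompl (aAct B N a) (g x)) :
    ∃ u ∈ equivariantHom A B M N, ∃ v ∈ equivariantHom A B N M, ∃ s ∉ p,
      (∀ x, v (u x) = s • x) ∧ ∀ y, u (v y) = s • y := by
  obtain ⟨u, v, s, hs, t, ht, hu, hvu, huv⟩ := exists_quasiInverse_of_localized_equiv p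
    (LocalizedModule.mkLinearMap p.primeCompl M) (LocalizedModule.mkLinearMap p.primeCompl N)
    (g.restrictScalars B)
  obtain ⟨r, hr, hrx⟩ := exists_notMem_forall_smul_eq_zero (X := N) p
  have hM : ∀ (a : A) x, LocalizedModule.mkLinearMap p.primeCompl M (a • x) =
      LocalizedModule.map p.primeCompl (aAct B M a)
        (LocalizedModule.mkLinearMap p.primeCompl M x) := fun a x => by
    rw [LocalizedModule.mkLinearMap_apply, LocalizedModule.mkLinearMap_apply,
      LocalizedModule.map_mk]
    rfl
  have hN : ∀ (a : A) x, LocalizedModule.mkLinearMap p.primeCompl N (a • x) =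
      LocalizedModule.map p.primeCompl (aAct B N a)
        (LocalizedModule.mkLinearMap p.primeCompl N x) := fun a x => by
    rw [LocalizedModule.mkLinearMap_apply, LocalizedModule.mkLinearMap_apply,
      LocalizedModule.map_mk]
    rfl
  have hru : ∀ (a : A) x, r • u (a • x) = r • a • u x := by
    intro a x
    rw [← sub_eq_zero, ← smul_sub]
    apply hrx
    have h0 : LocalizedModule.mkLinearMap p.primeCompl N (u (a • x) - a • u x) = 0 := by
      rw [map_sub, hN, hu, hu, sub_eq_zero, hM]
      change t • g _ = LocalizedModule.map p.primeCompl (aAct B N a) (t • g _)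
      rw [hg, LinearMap.map_smul_of_tower]
    obtain ⟨c, hc⟩ := (IsLocalizedModule.eq_zero_iff p.primeCompl _).1 h0
    exact ⟨c, c.2, hc⟩
  have hu' : r • u ∈ equivariantHom A B M N := fun a x => by
    rw [LinearMap.smul_apply, LinearMap.smul_apply, hru, smul_comm a r (u x)]
  refine ⟨r • u, hu', (r * s) • v, fun a y => ?_, r * (r * s) * s,
    hp.mul_notMem (hp.mul_notMem hr (hp.mul_notMem hr hs)) hs, fun x => ?_, fun y => ?_⟩
  · have h := hu' a (v y)
    rw [LinearMap.smul_apply, LinearMap.smul_apply, huv, smul_comm a r, smul_comm a s] at h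
    have h₂ := congrArg v h
    rw [map_smul, hvu, map_smul, map_smul] at h₂
    rw [LinearMap.smul_apply, LinearMap.smul_apply, mul_smul, mul_smul, ← h₂, smul_comm a r,
      smul_comm a s]
  · rw [LinearMap.smul_apply, LinearMap.smul_apply, map_smul, hvu, smul_smul, smul_smul]
    congr 1; ring
  · rw [LinearMap.smul_apply, LinearMap.smul_apply, map_smul, huv, smul_smul, smul_smul]

/-- A twist of `M` by an invertible module is locally isomorphic to `M`. -/
theorem exists_localized_equiv_of_tensor_equiv [IsNoetherianRing B]
    {L : Type*} [AddCommGroup L] [Module B L] [Module.Finite B L]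
    (φ : (M ⊗[B] L) ≃ₗ[B] N)
    (hφ : ∀ (a : A) (x : M ⊗[B] L), φ (LinearMap.rTensor L (aAct B M a) x) = a • φ x)
    (p : Ideal B) [p.IsPrime]
    (ψ : LocalizedModule p.primeCompl L ≃ₗ[Localization.AtPrime p] Localization.AtPrime p) :
    ∃ g : LocalizedModule p.primeCompl M ≃ₗ[Localization.AtPrime p]
        LocalizedModule p.primeCompl N,
      ∀ (a : A) (x : LocalizedModule p.primeCompl M),
        g (LocalizedModule.map p.primeCompl (aAct B M a) x) =
          LocalizedModule.map p.primeCompl (aAct B N a) (g x) := by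
  obtain ⟨u, v, s, hs, -, -, -, hvu, huv⟩ := exists_quasiInverse_of_localized_equiv p
    (Algebra.linearMap B (Localization.AtPrime p)) (LocalizedModule.mkLinearMap p.primeCompl L)
    (ψ.symm.restrictScalars B)
  let F : M →ₗ[B] N := φ.toLinearMap ∘ₗ LinearMap.lTensor M u ∘ₗ (TensorProduct.rid B M).symm
  let G : N →ₗ[B] M := (TensorProduct.rid B M) ∘ₗ LinearMap.lTensor M v ∘ₗ φ.symm.toLinearMap
  have hF : ∀ x, F x = φ (x ⊗ₜ u 1) := fun x => by simp [F]
  have hvu' : v ∘ₗ u = s • LinearMap.id := LinearMap.ext hvu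
  have huv' : u ∘ₗ v = s • LinearMap.id := LinearMap.ext huv
  have hGF : ∀ x, G (F x) = s • x := fun x => by
    change TensorProduct.rid B M (LinearMap.lTensor M v (φ.symm (φ (LinearMap.lTensor M u
      ((TensorProduct.rid B M).symm x))))) = _
    rw [φ.symm_apply_apply, ← LinearMap.lTensor_comp_apply, hvu', LinearMap.lTensor_smul]
    simp
  have hFG : ∀ y, F (G y) = s • y := fun y => by
    change φ (LinearMap.lTensor M u ((TensorProduct.rid B M).symm (TensorProduct.rid B M
      (LinearMap.lTensor M v (φ.symm y))))) = _
    rw [LinearEquiv.symm_apply_apply, ← LinearMap.lTensor_comp_apply, huv',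
      LinearMap.lTensor_smul]
    simp
  refine ⟨LinearEquiv.ofBijective (LocalizedModule.map p.primeCompl F)
    (LocalizedModule.map_bijective_of_quasiInverse p F G hs hGF hFG), fun a x => ?_⟩
  induction x using LocalizedModule.induction_on with
  | h x t =>
    simp only [LinearEquiv.ofBijective_apply, LocalizedModule.map_mk]
    congr 1
    rw [hF, hF]
    exact hφ a (x ⊗ₜ u 1)

/-- The evaluation map `M ⊗ L → N`, for a module `L` identified with the equivariant
homomorphisms `M → N`. -/
noncomputable def equivariantEval {L : Type*} [AddCommGroup L] [Module B L]
    (σ : L ≃ₗ[B] equivariantHom A B M N) : (M ⊗[B] L) →ₗ[B] N :=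
  TensorProduct.lift ((equivariantHom A B M N).subtype ∘ₗ σ.toLinearMap).flip

theorem equivariantEval_tmul {L : Type*} [AddCommGroup L] [Module B L]
    (σ : L ≃ₗ[B] equivariantHom A B M N) (x : M) (l : L) :
    equivariantEval σ (x ⊗ₜ l) = (σ l : M →ₗ[B] N) x := rfl

theorem equivariantEval_rTensor {L : Type*} [AddCommGroup L] [Module B L]
    (σ : L ≃ₗ[B] equivariantHom A B M N) (a : A) (x : M ⊗[B] L) :
    equivariantEval σ (LinearMap.rTensor L (aAct B M a) x) = a • equivariantEval σ x := by
  induction x using TensorProduct.induction_on with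
  | zero => simp
  | add x y hx hy => rw [map_add, map_add, hx, hy, map_add, smul_add]
  | tmul x l =>
    rw [LinearMap.rTensor_tmul, equivariantEval_tmul, equivariantEval_tmul]
    exact (σ l).2 a x

/-- If, locally at every maximal ideal, `M` and `N` are equivariantly isomorphic and the
equivariant endomorphisms of `M` are scalars, then evaluation is an isomorphism. -/
theorem equivariantEval_bijective {L : Type*} [AddCommGroup L] [Module B L]
    (σ : L ≃ₗ[B] equivariantHom A B M N)
    (hiso : ∀ (𝔪 : Ideal B) [𝔪.IsMaximal],
      ∃ u ∈ equivariantHom A B M N, ∃ v ∈ equivariantHom A B N M, ∃ s ∉ 𝔪,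
        (∀ x, v (u x) = s • x) ∧ ∀ y, u (v y) = s • y)
    (hscalar : ∀ (𝔪 : Ideal B) [𝔪.IsMaximal], ∀ h ∈ equivariantHom A B M M,
      ∃ t ∉ 𝔪, ∃ b : B, ∀ y, t • h y = b • y) :
    Function.Bijective (equivariantEval σ) := by
  constructor
  · rw [injective_iff_map_eq_zero]
    intro z hz
    rw [← Submodule.mem_bot B]
    refine Submodule.mem_of_forall_isMaximal_exists_smul_mem _ _ fun 𝔪 hmax => ?_
    have hp : 𝔪.IsPrime := hmax.isPrime
    obtain ⟨u, hu, v, hv, s, hs, hvu, huv⟩ := hiso 𝔪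
    obtain ⟨l, hl⟩ := σ.surjective ⟨u, hu⟩
    have key : ∀ z : M ⊗[B] L, ∃ t ∉ 𝔪, t • (v (equivariantEval σ z) ⊗ₜ[B] l) = t • s • z := by
      intro z
      induction z using TensorProduct.induction_on with
      | zero => exact ⟨1, 𝔪.one_notMem, by simp⟩
      | add x y hx hy =>
        obtain ⟨t₁, ht₁, h₁⟩ := hx
        obtain ⟨t₂, ht₂, h₂⟩ := hy
        refine ⟨t₁ * t₂, hp.mul_notMem ht₁ ht₂, ?_⟩
        rw [map_add, map_add, TensorProduct.add_tmul, smul_add, smul_add, smul_add,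
          mul_smul t₁ t₂ (_ ⊗ₜ[B] l), mul_smul t₁ t₂ (_ ⊗ₜ[B] l), mul_smul, mul_smul, h₂,
          smul_comm t₁ t₂ (_ ⊗ₜ[B] l), h₁, smul_comm t₁ t₂ (s • x)]
      | tmul x m =>
        obtain ⟨t, ht, b, hb⟩ := hscalar 𝔪 (v ∘ₗ (σ m : M →ₗ[B] N)) fun a x => by
          rw [LinearMap.comp_apply, (σ m).2 a x, hv a, LinearMap.comp_apply]
        have hlm : b • l = (t * s) • m := by
          apply σ.injective
          rw [map_smul, map_smul, hl]
          apply Subtype.ext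
          ext y
          have h' := congrArg u (hb y)
          rw [map_smul, map_smul, LinearMap.comp_apply, huv, smul_smul] at h'
          exact h'.symm
        refine ⟨t, ht, ?_⟩
        rw [equivariantEval_tmul, TensorProduct.smul_tmul']
        have := hb x
        rw [LinearMap.comp_apply] at this
        rw [this, TensorProduct.smul_tmul, hlm, TensorProduct.tmul_smul, smul_smul]
    obtain ⟨t, ht, h⟩ := key z
    refine ⟨t * s, hp.mul_notMem ht hs, ?_⟩
    rw [Submodule.mem_bot, mul_smul, ← h, hz, map_zero, TensorProduct.zero_tmul, smul_zero]
  · intro y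
    rw [← LinearMap.mem_range]
    refine Submodule.mem_of_forall_isMaximal_exists_smul_mem _ _ fun 𝔪 hmax => ?_
    obtain ⟨u, hu, v, hv, s, hs, hvu, huv⟩ := hiso 𝔪
    obtain ⟨l, hl⟩ := σ.surjective ⟨u, hu⟩
    exact ⟨s, hs, v y ⊗ₜ l, by rw [equivariantEval_tmul, hl, ← huv y]⟩

/-- Under the hypotheses of `equivariantEval_bijective`, the module of equivariant homomorphisms
is locally free of rank one wherever `M` has a functional that is locally a unit. -/
theorem nonempty_localizedModule_equivariantHom_equiv {L : Type*} [AddCommGroup L] [Module B L]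
    (σ : L ≃ₗ[B] equivariantHom A B M N) (𝔪 : Ideal B) [hp : 𝔪.IsPrime]
    (hiso : ∃ u ∈ equivariantHom A B M N, ∃ v ∈ equivariantHom A B N M, ∃ s ∉ 𝔪,
        (∀ x, v (u x) = s • x) ∧ ∀ y, u (v y) = s • y)
    (hscalar : ∀ h ∈ equivariantHom A B M M, ∃ t ∉ 𝔪, ∃ b : B, ∀ y, t • h y = b • y)
    (hfun : ∃ (ξ₀ : M →ₗ[B] B) (x₀ : M), ξ₀ x₀ ∉ 𝔪) :
    Nonempty (LocalizedModule 𝔪.primeCompl L ≃ₗ[Localization.AtPrime 𝔪]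
      Localization.AtPrime 𝔪) := by
  obtain ⟨u, hu, v, hv, s, hs, hvu, huv⟩ := hiso
  obtain ⟨ξ₀, x₀, h₀⟩ := hfun
  obtain ⟨l, hl⟩ := σ.surjective ⟨u, hu⟩
  refine nonempty_localizedModule_equiv_localization 𝔪 l (fun b hb => ?_) fun m => ?_
  · have hbu : b • (⟨u, hu⟩ : equivariantHom A B M N) = 0 := by
      rw [← hl, ← map_smul, hb, map_zero]
    have hbu' : b • u x₀ = 0 := LinearMap.congr_fun (congrArg Subtype.val hbu) x₀
    refine ⟨s * ξ₀ x₀, hp.mul_notMem hs h₀, ?_⟩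
    have := congrArg (fun y => ξ₀ (v y)) hbu'
    simp only [map_smul, hvu, map_zero, smul_eq_mul] at this
    rw [← this]; ring
  · obtain ⟨t, ht, b, hb⟩ := hscalar (v ∘ₗ (σ m : M →ₗ[B] N)) fun a x => by
      rw [LinearMap.comp_apply, (σ m).2 a x, hv a, LinearMap.comp_apply]
    refine ⟨t * s, hp.mul_notMem ht hs, b, ?_⟩
    apply σ.injective
    rw [map_smul, map_smul, hl]
    apply Subtype.ext
    ext y
    have h' := congrArg u (hb y)
    rw [map_smul, map_smul, LinearMap.comp_apply, huv, smul_smul] at h'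
    exact h'

end Equivariant

/-- A finitely generated module over a finite type `ℂ`-algebra is small in every universe. -/
theorem small_of_finite_of_finiteType.{v, w, x} {B : Type w} [CommRing B] [Algebra ℂ B]
    [Algebra.FiniteType ℂ B] (L : Type x) [AddCommGroup L] [Module B L] [Module.Finite B L] :
    Small.{v} L := by
  obtain ⟨n, f, hf⟩ := Algebra.FiniteType.iff_quotient_mvPolynomial''.1
    (inferInstance : Algebra.FiniteType ℂ B)
  have : Small.{v} B := small_of_surjective hf
  obtain ⟨k, g, hg⟩ := Module.Finite.exists_fin' B L
  exact small_of_surjective hg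

/-- A family whose closed fibres all have dimension vector zero vanishes. -/
theorem subsingleton_of_dimVec_fiber_eq_zero {A : Type*} [Ring A] [Algebra ℂ A] {ι : Type*}
    [Fintype ι] {e : ι → A} (hsum : ∑ i, e i = 1) (B : Type*) [CommRing B] [Algebra ℂ B]
    [Algebra.FiniteType ℂ B] {M : Type*} [AddCommGroup M] [Module ℂ M] [Module A M] [Module B M]
    [IsScalarTower ℂ A M] [IsScalarTower ℂ B M] [SMulCommClass A B M] [Module.Finite B M]
    (h : ∀ (𝔪 : Ideal B) [𝔪.IsMaximal] (i : ι), dimVec A e (M ⧸ fiberSub A M 𝔪) i = 0) :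
    Subsingleton M := by
  refine subsingleton_of_forall_isMaximal_smul_top (B := B) fun 𝔪 hmax => ?_
  obtain ⟨χ, hχ⟩ := exists_algHom_ker_eq (k := ℂ) 𝔪
  have := finiteDimensional_fiber (A := A) (M := M) hχ
  have := subsingleton_of_dimVec_eq_zero hsum (h 𝔪)
  exact eq_top_iff.2 fun x _ => mem_fiberSub.1
    ((Submodule.Quotient.mk_eq_zero (fiberSub A M 𝔪)).1 (Subsingleton.elim _ _))

/-- Two families `M`, `N` of `θ`-stable `A`-modules of dimension vector `d` over
`Spec B` (i.e. `A ⊗ B`-modules, finitely generated and flat over `B`, whose closed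
fibres are `θ`-stable of dimension vector `d`) become equivalent after twisting by a
rank-one projective `B`-module if and only if they are locally isomorphic at every
maximal ideal of `B`. -/
theorem equivalence_iff_locally_isomorphic
    (A : Type*) [Ring A] [Algebra ℂ A]
    (ι : Type*) [Fintype ι] (e : ι → A)
    (horth : ∀ i j, i ≠ j → e i * e j = 0) (hidem : ∀ i, e i * e i = e i)
    (hsum : ∑ i, e i = 1)
    (B : Type*) [CommRing B] [Algebra ℂ B] [Algebra.FiniteType ℂ B]
    (d : ι → ℕ) (θ : ι → ℤ) (hθd : ∑ i, θ i * (d i : ℤ) = 0)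
    (M : Type*) [AddCommGroup M] [Module ℂ M] [Module A M] [Module B M]
    [IsScalarTower ℂ A M] [IsScalarTower ℂ B M] [SMulCommClass A B M]
    [Module.Finite B M] [Module.Flat B M]
    (N : Type*) [AddCommGroup N] [Module ℂ N] [Module A N] [Module B N]
    [IsScalarTower ℂ A N] [IsScalarTower ℂ B N] [SMulCommClass A B N]
    [Module.Finite B N] [Module.Flat B N]
    (hMfib : ∀ (𝔪 : Ideal B) [𝔪.IsMaximal],
      (∀ i, dimVec A e (M ⧸ fiberSub A M 𝔪) i = d i) ∧
        Stable A e θ (M ⧸ fiberSub A M 𝔪))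
    (hNfib : ∀ (𝔪 : Ideal B) [𝔪.IsMaximal],
      (∀ i, dimVec A e (N ⧸ fiberSub A N 𝔪) i = d i) ∧
        Stable A e θ (N ⧸ fiberSub A N 𝔪)) :
    (∃ L : ModuleCat B,
        Module.Finite B L ∧ Module.Projective B L ∧
        (∀ (𝔪 : Ideal B) [𝔪.IsMaximal],
          Nonempty (LocalizedModule 𝔪.primeCompl L ≃ₗ[Localization.AtPrime 𝔪]
            Localization.AtPrime 𝔪)) ∧
        ∃ φ : (M ⊗[B] L) ≃ₗ[B] N,
          ∀ (a : A) (x : M ⊗[B] L),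
            φ (LinearMap.rTensor L (aAct B M a) x) = a • φ x)
    ↔
    (∀ (𝔪 : Ideal B) [𝔪.IsMaximal],
      ∃ g : LocalizedModule 𝔪.primeCompl M ≃ₗ[Localization.AtPrime 𝔪]
          LocalizedModule 𝔪.primeCompl N,
        ∀ (a : A) (x : LocalizedModule 𝔪.primeCompl M),
          g (LocalizedModule.map 𝔪.primeCompl (aAct B M a) x)
            = LocalizedModule.map 𝔪.primeCompl (aAct B N a) (g x)) := by
  have hnoeth : IsNoetherianRing B := Algebra.FiniteType.isNoetherianRing ℂ B
  constructor
  · rintro ⟨L, _, -, hloc, φ, hφ⟩ 𝔪 hmax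
    obtain ⟨ψ⟩ := hloc 𝔪
    exact exists_localized_equiv_of_tensor_equiv φ hφ 𝔪 ψ
  intro hloc
  have : Module.FinitePresentation B M := Module.finitePresentation_of_finite B M
  have : Module.Projective B M := Module.Flat.projective_of_finitePresentation
  by_cases hd : ∀ i, d i = 0
  · have hMsub : Subsingleton M := subsingleton_of_dimVec_fiber_eq_zero hsum B
      fun 𝔪 _ i => ((hMfib 𝔪).1 i).trans (hd i)
    have hNsub : Subsingleton N := subsingleton_of_dimVec_fiber_eq_zero hsum B
      fun 𝔪 _ i => ((hNfib 𝔪).1 i).trans (hd i)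
    have hsmall := small_of_finite_of_finiteType (B := B) B
    let σ := Shrink.linearEquiv B B
    refine ⟨ModuleCat.of B (Shrink B), Module.Finite.equiv σ.symm,
      Module.Projective.of_equiv σ.symm, fun 𝔪 hmax => ?_, ?_⟩
    · refine nonempty_localizedModule_equiv_localization 𝔪 (σ.symm 1) (fun b hb => ?_)
        fun h => ⟨1, 𝔪.one_notMem, σ h, ?_⟩
      · refine ⟨1, 𝔪.one_notMem, ?_⟩
        have := congrArg σ hb
        rwa [map_smul, map_zero, LinearEquiv.apply_symm_apply, smul_eq_mul, mul_comm] at this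
      · apply σ.injective
        rw [map_smul, map_smul, LinearEquiv.apply_symm_apply]
        simp
    · have : Subsingleton (M ⊗[B] ModuleCat.of B (Shrink B)) :=
        (TensorProduct.congr (LinearEquiv.refl B M) σ ≪≫ₗ
          TensorProduct.rid B M).toEquiv.subsingleton
      exact ⟨0, fun _ _ => Subsingleton.elim _ _⟩
  · push Not at hd
    obtain ⟨i₀, hi₀⟩ := hd
    have hnontriv : ∀ (𝔪 : Ideal B) [𝔪.IsMaximal], Nontrivial (M ⧸ fiberSub A M 𝔪) := by
      intro 𝔪 hmax
      by_contra hnt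
      rw [not_nontrivial_iff_subsingleton] at hnt
      apply hi₀
      rw [← (hMfib 𝔪).1 i₀, dimVec, Module.finrank_zero_of_subsingleton]
    have hscalar : ∀ (𝔪 : Ideal B) [𝔪.IsMaximal], ∀ h ∈ equivariantHom A B M M,
        ∃ t ∉ 𝔪, ∃ b : B, ∀ y, t • h y = b • y := by
      intro 𝔪 hmax h hA
      obtain ⟨χ, hχ⟩ := exists_algHom_ker_eq (k := ℂ) 𝔪
      have := finiteDimensional_fiber (A := A) (M := M) hχ
      have := hnontriv 𝔪
      obtain ⟨ξ₀, x₀, h₀⟩ := exists_functional_apply_notMem (hnontriv 𝔪)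
      have hθ : thetaVal A e θ (M ⧸ fiberSub A M 𝔪) = 0 := by
        rw [← hθd]
        exact Finset.sum_congr rfl fun i _ => by rw [(hMfib 𝔪).1 i]
      exact exists_smul_eq_smul_of_equivariant hχ
        ((hMfib 𝔪).2.exists_eq_smul hidem hθ) ξ₀ x₀ h₀ h hA
    have hiso : ∀ (𝔪 : Ideal B) [𝔪.IsMaximal],
        ∃ u ∈ equivariantHom A B M N, ∃ v ∈ equivariantHom A B N M, ∃ s ∉ 𝔪,
          (∀ x, v (u x) = s • x) ∧ ∀ y, u (v y) = s • y := fun 𝔪 hmax => by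
      obtain ⟨g, hg⟩ := hloc 𝔪
      exact exists_equivariant_quasiInverse 𝔪 g hg
    have hsmall := small_of_finite_of_finiteType (B := B) (equivariantHom A B M N)
    let σ := Shrink.linearEquiv B (equivariantHom A B M N)
    have hfin : Module.Finite B (Shrink (equivariantHom A B M N)) := Module.Finite.equiv σ.symm
    have hloc' : ∀ (𝔪 : Ideal B) [𝔪.IsMaximal],
        Nonempty (LocalizedModule 𝔪.primeCompl (Shrink (equivariantHom A B M N))
          ≃ₗ[Localization.AtPrime 𝔪] Localization.AtPrime 𝔪) := fun 𝔪 hmax =>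
      nonempty_localizedModule_equivariantHom_equiv σ 𝔪 (hiso 𝔪) (hscalar 𝔪)
        (exists_functional_apply_notMem (hnontriv 𝔪))
    have : Module.FinitePresentation B (Shrink (equivariantHom A B M N)) :=
      Module.finitePresentation_of_finite B _
    refine ⟨ModuleCat.of B (Shrink (equivariantHom A B M N)), hfin,
      Module.projective_of_localization_maximal fun 𝔪 hmax => ?_, hloc',
      LinearEquiv.ofBijective (equivariantEval σ) (equivariantEval_bijective σ hiso hscalar),
      fun a x => equivariantEval_rTensor σ a x⟩
    obtain ⟨ψ⟩ := hloc' 𝔪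
    exact Module.Projective.of_equiv ψ.symm
end

section
/- Let B be a commutative ring, S a commutative B-algebra, and G an S-module, regarded also as a B-module by restriction of scalars along the structure map B → S. Assume that G is a faithful S-module (if s ∈ S satisfies s • g = 0 for all g ∈ G then s = 0) and that, as a B-module, G is finitely generated, projective, and has localization G_𝔪 free of rank 1 over B_𝔪 for every maximal ideal 𝔪 of B. Then the structure homomorphism B → S is bijective. -/
/-- A finitely presented module which is free of rank one at every maximal ideal has only
scalar endomorphisms, and each scalar is determined by its action. -/
theorem Module.algebraMap_end_bijective_of_localizedModule_equiv
    (B G : Type*) [CommRing B] [AddCommGroup G] [Module B G] [Module.FinitePresentation B G]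
    (hloc : ∀ (𝔪 : Ideal B) [𝔪.IsMaximal],
      Nonempty (LocalizedModule 𝔪.primeCompl G ≃ₗ[Localization.AtPrime 𝔪]
        Localization.AtPrime 𝔪)) :
    Function.Bijective (algebraMap B (Module.End B G)) := by
  let f (P : Ideal B) [P.IsMaximal] := Algebra.linearMap B (Localization.AtPrime P)
  let g (P : Ideal B) [P.IsMaximal] :
      Module.End B G →ₗ[B] Module.End (Localization.AtPrime P) (LocalizedModule P.primeCompl G) :=
    IsLocalizedModule.mapExtendScalars P.primeCompl
      (LocalizedModule.mkLinearMap P.primeCompl G) (LocalizedModule.mkLinearMap P.primeCompl G)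
      (Localization.AtPrime P)
  have hg (P : Ideal B) [P.IsMaximal] : IsLocalizedModule P.primeCompl (g P) :=
    Module.FinitePresentation.isLocalizedModule_mapExtendScalars ..
  refine bijective_of_isLocalized_maximal _ f _ g (Algebra.linearMap B (Module.End B G))
    fun P _ ↦ ?_
  obtain ⟨e⟩ := hloc P
  have := Module.Invertible.congr e.symm
  have hmap : IsLocalizedModule.map P.primeCompl (f P) (g P)
      (Algebra.linearMap B (Module.End B G)) =
      (Algebra.linearMap (Localization.AtPrime P)
        (Module.End (Localization.AtPrime P) (LocalizedModule P.primeCompl G))).restrictScalars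
          B := by
    refine IsLocalizedModule.linearMap_ext P.primeCompl (f P) (g P) (LinearMap.ext_ring ?_)
    rw [LinearMap.comp_apply, IsLocalizedModule.map_apply]
    simp [f, g, Module.End.one_eq_id, IsLocalizedModule.mapExtendScalars]
    rfl
  rw [hmap]
  exact Module.Invertible.toModuleEnd_bijective (Localization.AtPrime P)
    (LocalizedModule P.primeCompl G)


/-- If `S` is a commutative `B`-algebra and `G` is a faithful `S`-module which, as a
`B`-module (by restriction of scalars), is finitely generated, projective and locally
free of rank one at every maximal ideal of `B`, then the structure map `B → S` is
bijective. -/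
theorem structureMap_bijective_of_faithful_line_module
    (B S G : Type*) [CommRing B] [CommRing S] [Algebra B S]
    [AddCommGroup G] [Module S G] [Module B G] [IsScalarTower B S G]
    (hfaithful : ∀ s : S, (∀ g : G, s • g = 0) → s = 0)
    [Module.Finite B G] [Module.Projective B G]
    (hloc : ∀ (𝔪 : Ideal B) [𝔪.IsMaximal],
      Nonempty (LocalizedModule 𝔪.primeCompl G ≃ₗ[Localization.AtPrime 𝔪]
        Localization.AtPrime 𝔪)) :
    Function.Bijective (algebraMap B S) := by
  have hFP := Module.finitePresentation_of_projective B G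
  have hend := Module.algebraMap_end_bijective_of_localizedModule_equiv B G hloc
  have hcomp (b : B) : Module.toModuleEnd B (S := S) G (algebraMap B S b) =
      algebraMap B (Module.End B G) b := by
    ext g
    simp
  have hinj : Function.Injective (Module.toModuleEnd B (S := S) G) :=
    (injective_iff_map_eq_zero _).2 fun s hs ↦ hfaithful s fun g ↦ LinearMap.congr_fun hs g
  refine ⟨fun a b hab ↦ hend.1 ?_, fun s ↦ ?_⟩
  · rw [← hcomp, ← hcomp, hab]
  · obtain ⟨b, hb⟩ := hend.2 (Module.toModuleEnd B (S := S) G s)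
    exact ⟨b, hinj ((hcomp b).trans hb)⟩
end

section
/- Let R := ℂ[ε]/(ε²), A := ℂ[x], and T := ℂ[x][ε]/(ε²), so T is isomorphic to A ⊗_ℂ R as a ℂ-algebra. For (a,b) ∈ ℂ² let M_{a,b} := T/(x − a − b·ε), the quotient of T by the ideal generated by x − a − b·ε, viewed as a T-module. Then: (i) every T-module M that is finitely generated and flat as an R-module and satisfies dim_ℂ(M/εM) = 1 is isomorphic as a T-module to M_{a,b} for some (a,b) ∈ ℂ²; (ii) M_{a,b} and M_{α,β} are isomorphic as T-modules if and only if (a,b) = (α,β); (iii) M_{a,b}/εM_{a,b} and M_{α,β}/εM_{α,β} are isomorphic as A-modules if and only if a = α. -/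
open DualNumber TrivSqZeroExt Polynomial

set_option synthInstance.maxHeartbeats 1000000
set_option maxHeartbeats 1000000

/-- `R = ℂ[ε]/(ε²)`, realised as the dual numbers over ℂ. -/
abbrev Reps : Type := DualNumber ℂ

/-- `T = ℂ[x][ε]/(ε²) ≅ ℂ[x] ⊗_ℂ ℂ[ε]/(ε²)`, realised as dual numbers over `ℂ[x]`. -/
abbrev Tcx : Type := DualNumber (Polynomial ℂ)

/-- The canonical ℂ-algebra map `R → T`, `ε ↦ ε`. -/
noncomputable def phiRT : Reps →ₐ[ℂ] Tcx :=
  DualNumber.lift ⟨(Algebra.ofId ℂ Tcx, DualNumber.eps),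
    DualNumber.eps_mul_eps, fun _ => Commute.all _ _⟩

/-- The element `x − a − b·ε` of `T`. -/
noncomputable def elt (a b : ℂ) : Tcx :=
  TrivSqZeroExt.inl (Polynomial.X - Polynomial.C a)
    - TrivSqZeroExt.inl (Polynomial.C b) * DualNumber.eps

/-- The `T`-module `M_{a,b} = T/(x − a − b·ε)`. -/
noncomputable def Mab (a b : ℂ) : Type := Tcx ⧸ Ideal.span {elt a b}

noncomputable instance (a b : ℂ) : CommRing (Mab a b) :=
  inferInstanceAs (CommRing (Tcx ⧸ Ideal.span {elt a b}))
noncomputable instance (a b : ℂ) : Module Tcx (Mab a b) :=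
  inferInstanceAs (Module Tcx (Tcx ⧸ Ideal.span {elt a b}))
noncomputable instance (a b : ℂ) : Algebra ℂ (Mab a b) :=
  inferInstanceAs (Algebra ℂ (Tcx ⧸ Ideal.span {elt a b}))
noncomputable instance (a b : ℂ) : IsScalarTower ℂ Tcx (Mab a b) :=
  inferInstanceAs (IsScalarTower ℂ Tcx (Tcx ⧸ Ideal.span {elt a b}))

/-- The submodule `ε·M` of a `T`-module `M`. -/
noncomputable def epsSub (M : Type*) [AddCommGroup M] [Module Tcx M] : Submodule Tcx M :=
  LinearMap.range (LinearMap.lsmul Tcx M DualNumber.eps)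

/-- The fibre `M_{a,b}/ε·M_{a,b}`, naturally a module over `A = ℂ[x]`. -/
noncomputable def fiberMab (a b : ℂ) : Type := Mab a b ⧸ epsSub (Mab a b)

noncomputable instance (a b : ℂ) : AddCommGroup (fiberMab a b) :=
  inferInstanceAs (AddCommGroup (Mab a b ⧸ epsSub (Mab a b)))
noncomputable instance (a b : ℂ) : Module Tcx (fiberMab a b) :=
  inferInstanceAs (Module Tcx (Mab a b ⧸ epsSub (Mab a b)))

/-- The `ℂ[x]`-module structure on the fibre, via `ℂ[x] → T`. -/
noncomputable instance (a b : ℂ) : Module (Polynomial ℂ) (fiberMab a b) :=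
  Module.compHom (fiberMab a b)
    (TrivSqZeroExt.inlAlgHom ℂ (Polynomial ℂ) (Polynomial ℂ)).toRingHom

/-- The evaluation `T → R`, `x ↦ a + b·ε`, `ε ↦ ε`. -/
noncomputable def evalT (a b : ℂ) : Tcx →ₐ[ℂ] Reps :=
  DualNumber.lift ⟨(Polynomial.aeval (algebraMap ℂ Reps a + algebraMap ℂ Reps b * DualNumber.eps),
    DualNumber.eps), DualNumber.eps_mul_eps, fun _ => Commute.all _ _⟩

lemma evalT_inl (a b : ℂ) (p : ℂ[X]) : evalT a b (TrivSqZeroExt.inl p) =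
    Polynomial.aeval (algebraMap ℂ Reps a + algebraMap ℂ Reps b * DualNumber.eps) p := by
  simp [evalT, DualNumber.lift_apply_inl]

lemma evalT_eps (a b : ℂ) : evalT a b DualNumber.eps = DualNumber.eps := by
  simp [evalT]

lemma phiRT_eps : phiRT DualNumber.eps = DualNumber.eps := by
  simp [phiRT]

lemma inl_C_eq_algebraMap (c : ℂ) :
    (TrivSqZeroExt.inl (Polynomial.C c) : Tcx) = algebraMap ℂ Tcx c := rfl

lemma evalT_elt (a b α β : ℂ) : evalT α β (elt a b) =
    algebraMap ℂ Reps (α - a) + algebraMap ℂ Reps (β - b) * DualNumber.eps := by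
  simp only [elt, map_sub, map_mul, evalT_inl, evalT_eps, aeval_X, aeval_C]
  ring

lemma evalT_eq_zero_of_mem {a b : ℂ} {t : Tcx} (ht : t ∈ Ideal.span {elt a b}) :
    evalT a b t = 0 := by
  obtain ⟨s, rfl⟩ := Ideal.mem_span_singleton'.1 ht
  simp [evalT_elt]

lemma mk_phiRT_evalT (a b : ℂ) (t : Tcx) :
    Ideal.Quotient.mk (Ideal.span {elt a b}) (phiRT (evalT a b t)) =
      Ideal.Quotient.mk (Ideal.span {elt a b}) t := by
  let f := ((Ideal.Quotient.mkₐ ℂ (Ideal.span {elt a b})).comp phiRT).comp (evalT a b)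
  let g := Ideal.Quotient.mkₐ ℂ (Ideal.span {elt a b})
  change f t = g t
  have hinl : f.comp (TrivSqZeroExt.inlAlgHom ℂ ℂ[X] ℂ[X]) =
      g.comp (TrivSqZeroExt.inlAlgHom ℂ ℂ[X] ℂ[X]) := by
    apply Polynomial.algHom_ext
    have hX : evalT a b (TrivSqZeroExt.inl X) =
        algebraMap ℂ Reps a + algebraMap ℂ Reps b * DualNumber.eps := by
      simp [evalT_inl]
    change Ideal.Quotient.mk (Ideal.span {elt a b}) (phiRT (evalT a b (TrivSqZeroExt.inl X))) =
      Ideal.Quotient.mk (Ideal.span {elt a b}) (TrivSqZeroExt.inl X)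
    rw [hX, eq_comm, Ideal.Quotient.eq]
    convert Ideal.mem_span_singleton_self (elt a b) using 1
    simp only [elt, map_add, map_mul, AlgHom.commutes, phiRT_eps, TrivSqZeroExt.inl_sub,
      inl_C_eq_algebraMap]
    ring
  have heps : f DualNumber.eps = g DualNumber.eps := by
    change Ideal.Quotient.mk (Ideal.span {elt a b}) (phiRT (evalT a b DualNumber.eps)) =
      Ideal.Quotient.mk (Ideal.span {elt a b}) DualNumber.eps
    rw [evalT_eps, phiRT_eps]
  have hinl' (p : ℂ[X]) : f (TrivSqZeroExt.inl p) = g (TrivSqZeroExt.inl p) :=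
    DFunLike.congr_fun hinl p
  have ht : t = TrivSqZeroExt.inl t.fst + TrivSqZeroExt.inl t.snd * DualNumber.eps := by
    ext <;> simp
  rw [ht, map_add, map_add, map_mul, map_mul, hinl', hinl', heps]

lemma sub_phiRT_evalT_mem (a b : ℂ) (t : Tcx) :
    t - phiRT (evalT a b t) ∈ Ideal.span {elt a b} :=
  Ideal.Quotient.eq.1 (mk_phiRT_evalT a b t).symm

lemma eq_of_elt_mem_span {a b α β : ℂ} (h : elt a b ∈ Ideal.span {elt α β}) : (a, b) = (α, β) := by
  have h0 := evalT_eq_zero_of_mem h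
  rw [evalT_elt] at h0
  have h1 := congrArg TrivSqZeroExt.fst h0
  have h2 := congrArg TrivSqZeroExt.snd h0
  simp [TrivSqZeroExt.algebraMap_eq_inl, sub_eq_zero] at h1 h2
  rw [h1, h2]

lemma nonempty_Mab_equiv_iff (a b α β : ℂ) :
    Nonempty (Mab a b ≃ₗ[Tcx] Mab α β) ↔ (a, b) = (α, β) := by
  constructor
  · rintro ⟨e⟩
    have h : Module.annihilator Tcx (Tcx ⧸ Ideal.span {elt a b}) =
      Module.annihilator Tcx (Tcx ⧸ Ideal.span {elt α β}) := LinearEquiv.annihilator_eq e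
    rw [Ideal.annihilator_quotient, Ideal.annihilator_quotient] at h
    exact eq_of_elt_mem_span (h ▸ Ideal.mem_span_singleton_self (elt a b))
  · rintro ⟨⟩
    exact ⟨LinearEquiv.refl _ _⟩

/-- The quotient map `T → M_{a,b}/ε·M_{a,b}`. -/
noncomputable def toFiber (a b : ℂ) : Tcx →ₗ[Tcx] fiberMab a b :=
  (epsSub (Mab a b)).mkQ ∘ₗ (Ideal.span {elt a b}).mkQ

lemma toFiber_surjective (a b : ℂ) : Function.Surjective (toFiber a b) :=
  (Submodule.mkQ_surjective (epsSub (Mab a b))).comp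
    (Submodule.mkQ_surjective (Ideal.span {elt a b}))

lemma toFiber_eq_zero_iff (a b : ℂ) (t : Tcx) :
    toFiber a b t = 0 ↔ ∃ s, t - DualNumber.eps * s ∈ Ideal.span {elt a b} := by
  have h : toFiber a b t = 0 ↔
      ((Ideal.span {elt a b}).mkQ t : Mab a b) ∈ epsSub (Mab a b) :=
    Submodule.Quotient.mk_eq_zero _
  rw [h]
  constructor
  · rintro ⟨m, hm⟩
    obtain ⟨s, rfl⟩ := Submodule.mkQ_surjective (Ideal.span {elt a b}) m
    exact ⟨s, (Submodule.Quotient.eq (Ideal.span {elt a b})).1 hm.symm⟩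
  · rintro ⟨s, hs⟩
    exact ⟨(Ideal.span {elt a b}).mkQ s,
      ((Submodule.Quotient.eq (Ideal.span {elt a b})).2 hs).symm⟩

/-- The map `ℂ[x] → M_{a,b}/ε·M_{a,b}`, `p ↦ p • 1`. -/
noncomputable def polyToFiber (a b : ℂ) : ℂ[X] →ₗ[ℂ[X]] fiberMab a b :=
  LinearMap.toSpanSingleton ℂ[X] (fiberMab a b) (toFiber a b 1)

lemma polyToFiber_apply (a b : ℂ) (p : ℂ[X]) :
    polyToFiber a b p = toFiber a b (TrivSqZeroExt.inl p) := by
  change (TrivSqZeroExt.inl p : Tcx) • toFiber a b 1 = _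
  rw [← map_smul, smul_eq_mul, mul_one]

lemma polyToFiber_surjective (a b : ℂ) : Function.Surjective (polyToFiber a b) := by
  intro y
  obtain ⟨t, rfl⟩ := toFiber_surjective a b y
  refine ⟨t.fst, ?_⟩
  rw [polyToFiber_apply, ← sub_eq_zero, ← map_sub, toFiber_eq_zero_iff]
  refine ⟨-TrivSqZeroExt.inl t.snd, ?_⟩
  convert zero_mem (Ideal.span {elt a b})
  ext <;> simp

lemma ker_polyToFiber (a b : ℂ) :
    LinearMap.ker (polyToFiber a b) = Ideal.span {X - C a} := by
  ext p
  rw [LinearMap.mem_ker, polyToFiber_apply, toFiber_eq_zero_iff, Ideal.mem_span_singleton,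
    dvd_iff_isRoot]
  constructor
  · rintro ⟨s, hs⟩
    have h := congrArg (TrivSqZeroExt.fstHom ℂ ℂ ℂ) (evalT_eq_zero_of_mem hs)
    rw [map_sub, map_sub, map_mul, map_mul, evalT_eps, evalT_inl, ← aeval_algHom_apply] at h
    simpa [TrivSqZeroExt.algebraMap_eq_inl] using h
  · intro h
    obtain ⟨q, rfl⟩ := dvd_iff_isRoot.2 h
    refine ⟨TrivSqZeroExt.inl (C b * q), Ideal.mem_span_singleton'.2 ⟨TrivSqZeroExt.inl q, ?_⟩⟩
    simp only [elt, TrivSqZeroExt.inl_mul]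
    ring

/-- The fibre `M_{a,b}/ε·M_{a,b}` is `ℂ[x]/(x − a)`. -/
noncomputable def fiberEquiv (a b : ℂ) :
    (ℂ[X] ⧸ Ideal.span {X - C a}) ≃ₗ[ℂ[X]] fiberMab a b :=
  (Submodule.quotEquivOfEq _ _ (ker_polyToFiber a b).symm).trans
    ((polyToFiber a b).quotKerEquivOfSurjective (polyToFiber_surjective a b))

lemma nonempty_fiberMab_equiv_iff (a b α β : ℂ) :
    Nonempty (fiberMab a b ≃ₗ[ℂ[X]] fiberMab α β) ↔ a = α := by
  constructor
  · rintro ⟨e⟩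
    have h := LinearEquiv.annihilator_eq ((fiberEquiv a b).trans (e.trans (fiberEquiv α β).symm))
    rw [Ideal.annihilator_quotient, Ideal.annihilator_quotient] at h
    have hm : X - C a ∈ Ideal.span {X - C α} := h ▸ Ideal.mem_span_singleton_self (X - C a)
    rw [Ideal.mem_span_singleton, dvd_iff_isRoot] at hm
    exact (root_X_sub_C.1 hm)
  · rintro rfl
    exact ⟨(fiberEquiv a b).symm.trans (fiberEquiv a β)⟩

/-- On a flat module over the dual numbers, the kernel of `ε` is contained in its image. -/
lemma exists_eps_smul_eq_of_flat {K M : Type*} [Field K] [AddCommGroup M]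
    [Module (DualNumber K) M] [Module.Flat (DualNumber K) M] {m : M}
    (hm : (DualNumber.eps : DualNumber K) • m = 0) :
    ∃ n : M, (DualNumber.eps : DualNumber K) • n = m := by
  obtain ⟨k, c, y, hy, hc⟩ := Module.Flat.isTrivialRelation_of_sum_smul_eq_zero
    (ι := Unit) (f := fun _ => (DualNumber.eps : DualNumber K)) (x := fun _ => m) (by simpa using hm)
  refine ⟨∑ j, (TrivSqZeroExt.inl (c () j).snd : DualNumber K) • y j, ?_⟩
  refine Eq.trans ?_ (hy ()).symm
  rw [Finset.smul_sum]
  refine Finset.sum_congr rfl fun j _ => ?_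
  rw [smul_smul]
  congr 1
  have h := congrArg TrivSqZeroExt.snd (hc j)
  simp at h
  ext <;> simp [h]

lemma exists_equiv_Mab (M : Type*) [AddCommGroup M] [Module ℂ M] [Module Tcx M] [Module Reps M]
    [IsScalarTower ℂ Tcx M] (hR : ∀ (r : Reps) (m : M), r • m = phiRT r • m)
    [Module.Flat Reps M] (hM : Module.finrank ℂ (M ⧸ epsSub M) = 1) :
    ∃ a b : ℂ, Nonempty (M ≃ₗ[Tcx] Mab a b) := by
  obtain ⟨v, hv, hspan⟩ := finrank_eq_one_iff'.1 hM
  obtain ⟨m, rfl⟩ := Submodule.mkQ_surjective _ v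
  have hm : ¬ ∃ n, (DualNumber.eps : Tcx) • n = m := fun h =>
    hv ((Submodule.Quotient.mk_eq_zero _).2 h)
  have hdecomp (w : M) : ∃ (c : ℂ) (n : M),
      w = algebraMap ℂ Tcx c • m + (DualNumber.eps : Tcx) • n := by
    obtain ⟨c, hc⟩ := hspan ((epsSub M).mkQ w)
    obtain ⟨n, hn⟩ := (Submodule.Quotient.eq (epsSub M)).1 (show
      Submodule.Quotient.mk w = Submodule.Quotient.mk (c • m) from hc.symm)
    refine ⟨c, n, ?_⟩
    rw [algebraMap_smul]
    exact (sub_eq_iff_eq_add'.1 hn.symm)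
  have hgen (w : M) : ∃ c d : ℂ,
      w = (algebraMap ℂ Tcx c + algebraMap ℂ Tcx d * DualNumber.eps) • m := by
    obtain ⟨c, n, rfl⟩ := hdecomp w
    obtain ⟨d, n', rfl⟩ := hdecomp n
    refine ⟨c, d, ?_⟩
    rw [smul_add, smul_smul, smul_smul, DualNumber.eps_mul_eps, zero_smul, add_zero, add_smul,
      mul_comm]
  obtain ⟨a, b, hab⟩ := hgen ((TrivSqZeroExt.inl X : Tcx) • m)
  have helt : elt a b • m = 0 := by
    rw [elt, TrivSqZeroExt.inl_sub, sub_sub, sub_smul, hab, sub_eq_zero]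
    rfl
  have hinj (r : Reps) (hr : phiRT r • m = 0) : r = 0 := by
    have hdec : r = algebraMap ℂ Reps r.fst + algebraMap ℂ Reps r.snd * DualNumber.eps := by
      ext <;> simp [TrivSqZeroExt.algebraMap_eq_inl]
    generalize r.fst = c at hdec
    generalize r.snd = d at hdec
    subst hdec
    have hc : c = 0 := by
      by_contra hc
      refine hm ⟨algebraMap ℂ Tcx (-(c⁻¹ * d)) • m, ?_⟩
      have h := congrArg (algebraMap ℂ Tcx c⁻¹ • ·) hr
      simp only [map_add, map_mul, AlgHom.commutes, phiRT_eps, smul_zero, smul_smul, mul_add,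
        ← mul_assoc] at h
      rw [← map_mul, ← map_mul, inv_mul_cancel₀ hc, map_one, add_smul, one_smul] at h
      rw [smul_smul, map_neg, mul_neg, neg_smul, mul_comm]
      exact (eq_neg_of_add_eq_zero_left h).symm
    subst hc
    have hd : d = 0 := by
      by_contra hd
      have h := congrArg (algebraMap ℂ Tcx d⁻¹ • ·) hr
      simp only [map_zero, zero_add, map_mul, AlgHom.commutes, phiRT_eps, smul_zero, smul_smul,
        ← mul_assoc] at h
      rw [← map_mul, inv_mul_cancel₀ hd, map_one, one_mul] at h
      have h' : (DualNumber.eps : Reps) • m = 0 := by rw [hR, phiRT_eps, h]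
      obtain ⟨n, hn⟩ := exists_eps_smul_eq_of_flat h'
      exact hm ⟨n, by rw [← hn, hR, phiRT_eps]⟩
    simp [hd]
  have hsurj : Function.Surjective (LinearMap.toSpanSingleton Tcx M m) := fun w => by
    obtain ⟨c, d, h⟩ := hgen w
    exact ⟨_, h.symm⟩
  have hker : LinearMap.ker (LinearMap.toSpanSingleton Tcx M m) = Ideal.span {elt a b} := by
    have hle : Ideal.span {elt a b} ≤ LinearMap.ker (LinearMap.toSpanSingleton Tcx M m) :=
      (Ideal.span_singleton_le_iff_mem _).2 helt
    refine le_antisymm (fun t ht => ?_) hle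
    have hsub : (t - phiRT (evalT a b t)) • m = 0 := hle (sub_phiRT_evalT_mem a b t)
    have ht' : t • m = 0 := ht
    rw [sub_smul, ht', zero_sub, neg_eq_zero] at hsub
    simpa [hinj _ hsub] using sub_phiRT_evalT_mem a b t
  exact ⟨a, b, ⟨((Submodule.quotEquivOfEq _ _ hker.symm).trans
    (LinearMap.quotKerEquivOfSurjective _ hsurj)).symm⟩⟩

/-- The counterexample of Appendix A: (i) every `T`-module which is finitely generated
and flat over `R` with one-dimensional fibre `M/εM` is isomorphic to some `M_{a,b}`;
(ii) `M_{a,b} ≅ M_{α,β}` as `T`-modules iff `(a,b) = (α,β)`; while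
(iii) the fibres `M_{a,b}/εM_{a,b}` and `M_{α,β}/εM_{α,β}` are isomorphic as
`ℂ[x]`-modules iff `a = α`. -/
theorem dual_numbers_counterexample :
    (∀ (M : Type) [AddCommGroup M] [Module ℂ M] [Module Tcx M] [Module Reps M]
        [IsScalarTower ℂ Tcx M],
        (∀ (r : Reps) (m : M), r • m = phiRT r • m) →
        Module.Finite Reps M → Module.Flat Reps M →
        Module.finrank ℂ (M ⧸ epsSub M) = 1 →
        ∃ a b : ℂ, Nonempty (M ≃ₗ[Tcx] Mab a b)) ∧
    (∀ a b α β : ℂ, Nonempty (Mab a b ≃ₗ[Tcx] Mab α β) ↔ (a, b) = (α, β)) ∧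
    (∀ a b α β : ℂ,
      Nonempty (fiberMab a b ≃ₗ[Polynomial ℂ] fiberMab α β) ↔ a = α) := by
  refine ⟨?_, nonempty_Mab_equiv_iff, nonempty_fiberMab_equiv_iff⟩
  intro M _ _ _ _ _ hR _ _ hM
  exact exists_equiv_Mab M hR hM
end
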